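/- Let λ be a partition with λ_1 > 0 and ℓ(λ) nonzero parts, and let S ⊆ {1,…,n} with |S| = ℓ(λ). Then every coefficient of each f*_μ (μ ∈ S_n(λ)), viewed as a rational function of q and t, is regular at q = 1, and, writing f*_μ(x;1,t) for the specialization at q = 1, Σ_{μ ∈ S_n(λ), Supp(μ) = S} f*_μ(x_1,…,x_n;1,t) = ∏_{i∈S}(x_i − t^{#(S^c ∩ {1,…,i−1})}/t^{n−1}) · ∏_{i=2}^{λ_1} e*_{λ'_i}(x_1,…,x_n;t), where Supp(μ) := {i : μ_i > 0}, S^c is the complement of S, and λ' is the conjugate partition of λ. -/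

import Mathlib

open MvPolynomial

noncomputable section
open scoped Classical

/-- The field `K = ℚ(q,t)`. -/
abbrev K : Type := FractionRing (MvPolynomial (Fin 2) ℚ)

/-- The indeterminate `q` as an element of `K`. -/
def qq : K := algebraMap (MvPolynomial (Fin 2) ℚ) K (X 0)

/-- The indeterminate `t` as an element of `K`. -/
def tt : K := algebraMap (MvPolynomial (Fin 2) ℚ) K (X 1)

/-- The size `|ν|` of a composition. -/
def csize {n : ℕ} (ν : Fin n → ℕ) : ℕ := ∑ i, ν i

/-- `k_i(ν) = #{j < i : ν_j > ν_i} + #{j > i : ν_j ≥ ν_i}`. -/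
def kstat {n : ℕ} (ν : Fin n → ℕ) (i : Fin n) : ℕ :=
  Set.ncard {j : Fin n | j < i ∧ ν i < ν j} + Set.ncard {j : Fin n | i < j ∧ ν i ≤ ν j}

/-- The evaluation point `ν̃ = (q^{ν_i} t^{-k_i(ν)})_i`. -/
def evalPt {n : ℕ} (ν : Fin n → ℕ) : Fin n → K :=
  fun i => qq ^ ν i * tt ^ (-(kstat ν i : ℤ))

/-- Weakly decreasing composition. -/
def IsPartition {n : ℕ} (l : Fin n → ℕ) : Prop := ∀ i j : Fin n, i ≤ j → l j ≤ l i

/-- The action `σ·μ := μ ∘ σ⁻¹`. -/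
def permAct {n : ℕ} (σ : Equiv.Perm (Fin n)) (μ : Fin n → ℕ) : Fin n → ℕ := μ ∘ ⇑σ.symm

/-- `S_n(λ)`: the rearrangements of `λ`. -/
def Sn {n : ℕ} (l : Fin n → ℕ) : Set (Fin n → ℕ) :=
  {μ | ∃ σ : Equiv.Perm (Fin n), permAct σ l = μ}

/-- The rearrangements of `λ` as a `Finset`. -/
def SnFinset {n : ℕ} (l : Fin n → ℕ) : Finset (Fin n → ℕ) :=
  Finset.image (fun σ : Equiv.Perm (Fin n) => permAct σ l) Finset.univ

/-- The exponent `Finsupp` of the monomial `x^μ`. -/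
def expOf {n : ℕ} (μ : Fin n → ℕ) : Fin n →₀ ℕ := Finsupp.equivFunOnFinite.symm μ

/-- Characterization of the interpolation nonsymmetric Macdonald polynomial `E*_μ`. -/
def IsEstar {n : ℕ} (μ : Fin n → ℕ) (f : MvPolynomial (Fin n) K) : Prop :=
  f.totalDegree ≤ csize μ ∧ coeff (expOf μ) f = 1 ∧
    ∀ ν : Fin n → ℕ, csize ν ≤ csize μ → ν ≠ μ → eval (evalPt ν) f = 0

/-- The interpolation nonsymmetric Macdonald polynomial `E*_μ` (unique by Knop–Sahi). -/
def Estar {n : ℕ} (μ : Fin n → ℕ) : MvPolynomial (Fin n) K :=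
  if h : ∃ f, IsEstar μ f then h.choose else 0

/-- Characterization of the interpolation (symmetric) Macdonald polynomial `P*_λ`. -/
def IsPstar {n : ℕ} (l : Fin n → ℕ) (f : MvPolynomial (Fin n) K) : Prop :=
  f.IsSymmetric ∧ f.totalDegree ≤ csize l ∧ coeff (expOf l) f = 1 ∧
    ∀ ν : Fin n → ℕ, IsPartition ν → csize ν ≤ csize l → ν ≠ l → eval (evalPt ν) f = 0

/-- The interpolation Macdonald polynomial `P*_λ`. -/
def Pstar {n : ℕ} (l : Fin n → ℕ) : MvPolynomial (Fin n) K :=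
  if h : ∃ f, IsPstar l f then h.choose else 0

/-- The space `V*_λ`. -/
def Vstar {n : ℕ} (l : Fin n → ℕ) : Submodule K (MvPolynomial (Fin n) K) :=
  (restrictTotalDegree (Fin n) K (csize l)) ⊓
    ⨅ (ν : Fin n → ℕ) (_ : csize ν ≤ csize l ∧ ν ∉ Sn l),
      LinearMap.ker (aeval (R := K) (evalPt ν)).toLinearMap

/-- Exchange of the variables `x_i` and `x_j` in a polynomial. -/
def swapVars {n : ℕ} (i j : Fin n) (f : MvPolynomial (Fin n) K) : MvPolynomial (Fin n) K :=
  rename (Equiv.swap i j) f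

/-- Exact division of polynomials: the unique `g` with `a = b * g` when it exists. -/
def exactDiv {n : ℕ} (a b : MvPolynomial (Fin n) K) : MvPolynomial (Fin n) K :=
  if h : ∃ g, a = b * g then h.choose else 0

/-- The Hecke operator
`T f = t f − ((t x_i − x_j)/(x_i − x_j))·(f − s_i f)` (where `j = i+1`). -/
def hecke {n : ℕ} (i j : Fin n) (f : MvPolynomial (Fin n) K) : MvPolynomial (Fin n) K :=
  C tt * f - (C tt * X i - X j) * exactDiv (f - swapVars i j f) (X i - X j)

/-- The Coxeter length of a permutation (number of inversions). -/
def permLength {n : ℕ} (σ : Equiv.Perm (Fin n)) : ℕ :=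
  Set.ncard {p : Fin n × Fin n | p.1 < p.2 ∧ σ p.2 < σ p.1}

/-- The adjacent transposition `s_i = (i, i+1)` (0-indexed). -/
def adjSwap {n : ℕ} (i : {i : ℕ // i + 1 < n}) : Equiv.Perm (Fin n) :=
  Equiv.swap ⟨i.1, Nat.lt_of_succ_lt i.2⟩ ⟨i.1 + 1, i.2⟩

/-- The Hecke operator `T_i` for an adjacent transposition index. -/
def heckeAt {n : ℕ} (i : {i : ℕ // i + 1 < n}) :
    MvPolynomial (Fin n) K → MvPolynomial (Fin n) K :=
  hecke ⟨i.1, Nat.lt_of_succ_lt i.2⟩ ⟨i.1 + 1, i.2⟩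

/-- `T_{i_1} ⋯ T_{i_ℓ} f` for a word `w = [i_1, …, i_ℓ]`. -/
def Tword {n : ℕ} (w : List {i : ℕ // i + 1 < n}) (f : MvPolynomial (Fin n) K) :
    MvPolynomial (Fin n) K :=
  w.foldr heckeAt f

/-- `w` is a reduced word for `σ`. -/
def IsReducedWordOf {n : ℕ} (w : List {i : ℕ // i + 1 < n}) (σ : Equiv.Perm (Fin n)) : Prop :=
  (w.map adjSwap).prod = σ ∧ w.length = permLength σ

/-- `T_σ`, computed from a reduced word of `σ` (independent of the choice, by the
Hecke algebra relations). -/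
def Tsigma {n : ℕ} (σ : Equiv.Perm (Fin n)) :
    MvPolynomial (Fin n) K → MvPolynomial (Fin n) K :=
  if h : ∃ w, IsReducedWordOf w σ then Tword h.choose else id

/-- `σ_μ`: the (unique) shortest permutation with `σ·l = μ`. -/
def sigmaMin {n : ℕ} (l μ : Fin n → ℕ) : Equiv.Perm (Fin n) :=
  if h : ∃ σ, permAct σ l = μ ∧ ∀ τ, permAct τ l = μ → permLength σ ≤ permLength τ then
    h.choose else 1

/-- The weakly decreasing rearrangement of a composition. -/
def sortDesc {n : ℕ} (μ : Fin n → ℕ) : Fin n → ℕ :=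
  if h : ∃ l, IsPartition l ∧ μ ∈ Sn l then h.choose else μ

/-- The interpolation ASEP polynomial `f*_μ = T_{σ_μ} E*_λ`, where `λ` is the weakly
decreasing rearrangement of `μ`. -/
def fstar {n : ℕ} (μ : Fin n → ℕ) : MvPolynomial (Fin n) K :=
  Tsigma (sigmaMin (sortDesc μ) μ) (Estar (sortDesc μ))

/-- The composition with entries `i` and `j` exchanged. -/
def swapEntries {n : ℕ} (i j : Fin n) (μ : Fin n → ℕ) : Fin n → ℕ := μ ∘ ⇑(Equiv.swap i j)
/-- The field `K1 = ℚ(t)`. -/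
abbrev K1 : Type := FractionRing (Polynomial ℚ)

/-- The indeterminate `t` as an element of `K1`. -/
def t1 : K1 := algebraMap (Polynomial ℚ) K1 Polynomial.X

/-- Specialization `q = 1` on `ℚ[q,t]`, landing in `ℚ(t)`. -/
def specQ1 : MvPolynomial (Fin 2) ℚ →+* K1 :=
  (MvPolynomial.aeval (fun i : Fin 2 => if i = 0 then (1 : K1) else t1)).toRingHom

/-- `c ∈ K = ℚ(q,t)` is regular at `q = 1` with value `v ∈ ℚ(t)`. -/
def RegAtQ1 (c : K) (v : K1) : Prop :=
  ∃ a b : MvPolynomial (Fin 2) ℚ, b ≠ 0 ∧ specQ1 b ≠ 0 ∧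
    c = algebraMap (MvPolynomial (Fin 2) ℚ) K a / algebraMap (MvPolynomial (Fin 2) ℚ) K b ∧
    v = specQ1 a / specQ1 b

/-- The inhomogeneous elementary symmetric polynomial `e*_k(x_1,…,x_n;t)`, over `ℚ(t)`. -/
def estarElem1 (n k : ℕ) : MvPolynomial (Fin n) K1 :=
  ∑ S ∈ Finset.powersetCard k (Finset.univ : Finset (Fin n)),
    ∏ i ∈ S,
      (X i - C (t1 ^ (Finset.univ.filter (fun j : Fin n => j < i ∧ j ∉ S)).card
        / t1 ^ (n - 1)))

/-- `λ'_m = #{i : λ_i ≥ m}`, the parts of the conjugate partition. -/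
def conjPart {n : ℕ} (l : Fin n → ℕ) (m : ℕ) : ℕ :=
  (Finset.univ.filter (fun i : Fin n => m ≤ l i)).card

namespace IA
set_option linter.unusedSectionVars false

section generic
variable {A : Type*} [CommRing A] {n : ℕ}

/-- An element dividing the difference of two algebra maps on generators divides it everywhere. -/
theorem dvd_sub_of_gens {B : Type*} [CommRing B] {m : Type*} (φ ψ : MvPolynomial m A →+* B) (d : B)
    (hC : ∀ a, φ (C a) = ψ (C a)) (h : ∀ i, d ∣ φ (X i) - ψ (X i)) (f : MvPolynomial m A) :
    d ∣ φ f - ψ f := by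
  induction f using MvPolynomial.induction_on with
  | C a => simp [hC]
  | add p q hp hq =>
    have : φ (p + q) - ψ (p + q) = (φ p - ψ p) + (φ q - ψ q) := by simp only [map_add]; ring
    rw [this]; exact dvd_add hp hq
  | mul_X p i hp =>
    have : φ (p * X i) - ψ (p * X i) = (φ p - ψ p) * φ (X i) + ψ p * (φ (X i) - ψ (X i)) := by
      simp only [map_mul]; ring
    rw [this]
    exact dvd_add (Dvd.dvd.mul_right hp _) (Dvd.dvd.mul_left (h i) _)

/-- Generic divided difference. -/
def ddG (i j : Fin n) (f : MvPolynomial (Fin n) A) : MvPolynomial (Fin n) A :=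
  if h : ∃ g, f - rename (Equiv.swap i j) f = (X i - X j) * g then h.choose else 0

/-- Generic Hecke operator. -/
def TG (t : A) (i j : Fin n) (f : MvPolynomial (Fin n) A) : MvPolynomial (Fin n) A :=
  C t * f - (C t * X i - X j) * ddG i j f

theorem ddG_spec (i j : Fin n) (f : MvPolynomial (Fin n) A) :
    f - rename (Equiv.swap i j) f = (X i - X j) * ddG i j f := by
  have h : ∃ g, f - rename (Equiv.swap i j) f = (X i - X j) * g := by
    have := dvd_sub_of_gens (A := A) (RingHom.id (MvPolynomial (Fin n) A))
      (rename (Equiv.swap i j) : MvPolynomial (Fin n) A →ₐ[A] _).toRingHom (X i - X j)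
      (by intro a; simp) (by
        intro k
        by_cases h1 : k = i
        · subst h1; simp
        by_cases h2 : k = j
        · subst h2
          refine ⟨-1, ?_⟩
          simp
        · simp [Equiv.swap_apply_of_ne_of_ne h1 h2]) f
    obtain ⟨g, hg⟩ := this
    exact ⟨g, by simpa using hg⟩
  unfold ddG
  rw [dif_pos h]
  exact h.choose_spec

theorem hecke_eq (i j : Fin n) (f : MvPolynomial (Fin n) K) : hecke i j f = TG tt i j f := rfl

theorem TG_spec (t : A) (i j : Fin n) (f : MvPolynomial (Fin n) A) :
    (X i - X j) * TG t i j f =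
      C (1 - t) * X j * f + (C t * X i - X j) * rename (Equiv.swap i j) f := by
  have h := ddG_spec i j f
  unfold TG
  rw [map_sub, map_one]
  linear_combination (C t * X i - X j) * h

theorem X_sub_X_ne [Nontrivial A] {i j : Fin n} (h : i ≠ j) :
    (X i - X j : MvPolynomial (Fin n) A) ≠ 0 := by
  rw [sub_ne_zero]
  intro h'
  exact h (X_injective h')

variable [IsDomain A]

theorem TG_unique (t : A) {i j : Fin n} (hij : i ≠ j) {f h : MvPolynomial (Fin n) A}
    (H : (X i - X j) * h =
      C (1 - t) * X j * f + (C t * X i - X j) * rename (Equiv.swap i j) f) :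
    TG t i j f = h := by
  apply mul_left_cancel₀ (X_sub_X_ne (A := A) hij)
  rw [TG_spec, H]

/-- The Hecke operator as a linear map. -/
def TL (t : A) {i j : Fin n} (hij : i ≠ j) :
    MvPolynomial (Fin n) A →ₗ[A] MvPolynomial (Fin n) A where
  toFun := TG t i j
  map_add' f g := by
    apply TG_unique t hij
    rw [mul_add, TG_spec, TG_spec, map_add]; ring
  map_smul' a f := by
    apply TG_unique t hij
    simp only [smul_eq_C_mul, RingHom.id_apply, map_mul, rename_C]
    have := TG_spec t i j f
    linear_combination C a * this

theorem TL_apply (t : A) {i j : Fin n} (hij : i ≠ j) (f : MvPolynomial (Fin n) A) :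
    TL t hij f = TG t i j f := rfl

theorem TG_sym_mul (t : A) {i j : Fin n} (hij : i ≠ j) (g f : MvPolynomial (Fin n) A)
    (hg : rename (Equiv.swap i j) g = g) : TG t i j (g * f) = g * TG t i j f := by
  apply TG_unique t hij
  rw [map_mul, hg]
  have := TG_spec t i j f
  linear_combination g * this

theorem TG_sym (t : A) {i j : Fin n} (hij : i ≠ j) (g : MvPolynomial (Fin n) A)
    (hg : rename (Equiv.swap i j) g = g) : TG t i j g = C t * g := by
  apply TG_unique t hij
  rw [hg, map_sub, map_one]
  ring

theorem sym_of_TG (t : A) {i j : Fin n} (hij : i ≠ j) (ht : t ≠ 0) (g : MvPolynomial (Fin n) A)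
    (hg : TG t i j g = C t * g) : rename (Equiv.swap i j) g = g := by
  have h := TG_spec t i j g
  rw [hg, map_sub, map_one] at h
  have h2 : (C t * X i - X j) * (rename (Equiv.swap i j) g - g) = 0 := by
    linear_combination -h
  rcases mul_eq_zero.mp h2 with h3 | h3
  · exfalso
    have := congrArg (coeff (Finsupp.single i 1)) h3
    have h6 : (Finsupp.single j 1 : Fin n →₀ ℕ) ≠ Finsupp.single i 1 := by
      intro h5
      exact hij (Finsupp.single_left_injective one_ne_zero h5).symm
    simp only [coeff_sub, coeff_C_mul, coeff_X, coeff_zero, if_neg h6] at this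
    simp at this
    exact ht this
  · exact sub_eq_zero.mp h3

theorem rename_swap_swap (i j : Fin n) (f : MvPolynomial (Fin n) A) :
    rename (Equiv.swap i j) (rename (Equiv.swap i j) f) = f := by
  rw [rename_rename]
  have : (⇑(Equiv.swap i j) ∘ ⇑(Equiv.swap i j)) = id := by
    funext x; simp
  rw [this, rename_id_apply]

/-- `(T_i + 1) f` is symmetric. -/
theorem TG_add_one_sym (t : A) {i j : Fin n} (hij : i ≠ j) (f : MvPolynomial (Fin n) A) :
    rename (Equiv.swap i j) (TG t i j f + f) = TG t i j f + f := by
  apply mul_left_cancel₀ (X_sub_X_ne (A := A) hij)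
  have h := TG_spec t i j f
  have h2 := congrArg (rename (Equiv.swap i j)) h
  simp only [map_mul, map_add, map_sub, rename_X, rename_C, rename_swap_swap,
    Equiv.swap_apply_left, Equiv.swap_apply_right, map_one] at h h2 ⊢
  linear_combination -h2 - h

theorem TG_map {B : Type*} [CommRing B] [IsDomain B] (φ : A →+* B) (t : A) {i j : Fin n}
    (hij : i ≠ j) (f : MvPolynomial (Fin n) A) :
    map φ (TG t i j f) = TG (φ t) i j (map φ f) := by
  symm
  apply TG_unique _ hij
  have h := congrArg (map φ) (TG_spec t i j f)
  simpa [map_rename] using h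

theorem TG_eval (t : A) (i j : Fin n) (f : MvPolynomial (Fin n) A) (y : Fin n → A) :
    (y i - y j) * eval y (TG t i j f) =
      (1 - t) * y j * eval y f + (t * y i - y j) * eval (y ∘ Equiv.swap i j) f := by
  have h := congrArg (eval y) (TG_spec t i j f)
  simpa [eval_rename] using h

/-! monomials indexed by functions -/

theorem expOf_apply (μ : Fin n → ℕ) (i : Fin n) : expOf μ i = μ i := rfl

theorem expOf_coe (p : Fin n →₀ ℕ) : expOf (⇑p) = p := by ext i; rfl

theorem expOf_inj {μ ν : Fin n → ℕ} : expOf μ = expOf ν ↔ μ = ν :=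
  Finsupp.equivFunOnFinite.symm.injective.eq_iff

theorem expOf_add (μ ν : Fin n → ℕ) : expOf (μ + ν) = expOf μ + expOf ν := by ext i; rfl

theorem coeff_rename_perm (σ : Equiv.Perm (Fin n)) (f : MvPolynomial (Fin n) A) (μ : Fin n → ℕ) :
    coeff (expOf μ) (rename σ f) = coeff (expOf (μ ∘ σ)) f := by
  rw [← coeff_rename_mapDomain σ σ.injective f (expOf (μ ∘ σ))]
  congr 1
  ext i
  have : i = σ (σ.symm i) := by simp
  rw [this, Finsupp.mapDomain_apply σ.injective]
  rfl

/-- monomial `x^ν` -/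
def mm (A : Type*) [CommRing A] {n : ℕ} (ν : Fin n → ℕ) : MvPolynomial (Fin n) A :=
  monomial (expOf ν) 1

theorem mm_eq_prod (ν : Fin n → ℕ) : mm A ν = ∏ i, X i ^ ν i := by
  unfold mm
  rw [monomial_eq, Finsupp.prod_fintype]
  · simp [expOf_apply]
  · simp

theorem coeff_mm (ν p : Fin n → ℕ) : coeff (expOf p) (mm A ν) = if ν = p then 1 else 0 := by
  unfold mm
  rw [coeff_monomial]
  simp [expOf_inj]

theorem rename_mm (σ : Equiv.Perm (Fin n)) (ν : Fin n → ℕ) :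
    rename σ (mm A ν) = mm A (ν ∘ σ.symm) := by
  rw [mm_eq_prod, mm_eq_prod]
  simp only [map_prod, map_pow, rename_X]
  apply Fintype.prod_equiv σ
  intro x; simp

/-- replace the two entries -/
def line (ν : Fin n → ℕ) (i j : Fin n) (a b : ℕ) : Fin n → ℕ :=
  fun k => if k = i then a else if k = j then b else ν k

theorem mm_line (ν : Fin n → ℕ) {i j : Fin n} (hij : i ≠ j) (a b : ℕ) :
    mm A (line ν i j a b) = mm A (line ν i j 0 0) * (X i ^ a * X j ^ b) := by
  simp only [mm_eq_prod]
  have h : ∀ k, (X k : MvPolynomial (Fin n) A) ^ line ν i j a b k =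
      X k ^ line ν i j 0 0 k * ((if k = i then X k ^ a else 1) * (if k = j then X k ^ b else 1)) := by
    intro k
    unfold line
    by_cases h1 : k = i
    · subst h1; simp [hij]
    · by_cases h2 : k = j
      · subst h2; simp [h1]
      · simp [h1, h2]
  rw [Finset.prod_congr rfl (fun k _ => h k)]
  rw [Finset.prod_mul_distrib, Finset.prod_mul_distrib]
  congr 2
  · simp
  · simp

theorem line_self (ν : Fin n → ℕ) (i j : Fin n) : line ν i j (ν i) (ν j) = ν := by
  funext k; unfold line; split_ifs with h1 h2
  · rw [h1]
  · rw [h2]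
  · rfl

theorem line_swap (ν : Fin n → ℕ) {i j : Fin n} (hij : i ≠ j) :
    line ν i j (ν j) (ν i) = ν ∘ Equiv.swap i j := by
  funext k; unfold line; split_ifs with h1 h2
  · subst h1; simp
  · subst h2; simp
  · simp [Equiv.swap_apply_of_ne_of_ne h1 h2]

theorem geomS (x y : A) (m : ℕ) :
    (x - y) * ∑ k ∈ Finset.range m, x ^ (k + 1) * y ^ (m - k) = x ^ (m + 1) * y - x * y ^ (m + 1) := by
  induction m with
  | zero => simp
  | succ m ih =>
    rw [Finset.sum_range_succ]
    have : ∑ k ∈ Finset.range m, x ^ (k + 1) * y ^ (m + 1 - k) =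
        y * ∑ k ∈ Finset.range m, x ^ (k + 1) * y ^ (m - k) := by
      rw [Finset.mul_sum]
      apply Finset.sum_congr rfl
      intro k hk
      have hk := Finset.mem_range.mp hk
      rw [show m + 1 - k = (m - k) + 1 by omega]; ring
    rw [this, show m + 1 - m = 1 by omega]
    linear_combination y * ih

/-- strict inner points of a line -/
def Inner (i j : Fin n) (ν p : Fin n → ℕ) : Prop :=
  (∀ k, k ≠ i → k ≠ j → p k = ν k) ∧ p i + p j = ν i + ν j ∧
    max (p i) (p j) < max (ν i) (ν j)

theorem rename_line (ν : Fin n → ℕ) {i j : Fin n} (hij : i ≠ j) (a b : ℕ) :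
    rename (Equiv.swap i j) (mm A (line ν i j a b)) = mm A (line ν i j b a) := by
  rw [rename_mm]
  congr 1
  funext k
  by_cases h1 : k = i
  · subst h1; simp [line, hij.symm]
  · by_cases h2 : k = j
    · subst h2; simp [line, h1]
    · simp [line, Equiv.swap_apply_of_ne_of_ne h1 h2, h1, h2]

theorem TG_mm_gt (t : A) {i j : Fin n} (hij : i ≠ j) (ν : Fin n → ℕ) (b m : ℕ) :
    TG t i j (mm A (line ν i j (b + m + 1) b)) = mm A (line ν i j b (b + m + 1)) +
      C (1 - t) * ∑ k ∈ Finset.range m, mm A (line ν i j (b + k + 1) (b + (m - k))) := by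
  apply TG_unique t hij
  rw [rename_line _ hij]
  simp only [mm_line ν hij (b + m + 1) b, mm_line ν hij b (b + m + 1)]
  have : ∑ k ∈ Finset.range m, mm A (line ν i j (b + k + 1) (b + (m - k))) =
      mm A (line ν i j 0 0) * (X i ^ b * X j ^ b) *
        ∑ k ∈ Finset.range m, X i ^ (k + 1) * X j ^ (m - k) := by
    rw [Finset.mul_sum]
    apply Finset.sum_congr rfl
    intro k _
    rw [mm_line ν hij]; ring
  rw [this]
  have h := geomS (X i : MvPolynomial (Fin n) A) (X j) m
  simp only [map_sub, map_one]
  linear_combination (1 - C t) * mm A (line ν i j 0 0) * (X i ^ b * X j ^ b) * h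

theorem coeff_inner_sum {i j : Fin n} (hij : i ≠ j) (ν : Fin n → ℕ) (b m : ℕ) (p : Fin n → ℕ)
    (h : ¬ Inner i j (line ν i j (b + m + 1) b) p) (h' : ¬ Inner i j (line ν i j b (b + m + 1)) p) :
    coeff (expOf p) (∑ k ∈ Finset.range m, mm A (line ν i j (b + k + 1) (b + (m - k)))) = 0 := by
  rw [coeff_sum]
  apply Finset.sum_eq_zero
  intro k hk
  have hk := Finset.mem_range.mp hk
  rw [coeff_mm, if_neg]
  intro hp
  apply h
  subst hp
  refine ⟨?_, ?_, ?_⟩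
  · intro k h1 h2; simp [line, h1, h2]
  · simp [line, hij.symm]; omega
  · simp [line, hij.symm]; omega

theorem coeff_TG_mm (t : A) {i j : Fin n} (hij : i ≠ j) (ν p : Fin n → ℕ) (h : ¬ Inner i j ν p) :
    coeff (expOf p) (TG t i j (mm A ν)) =
      if ν j < ν i then (if ν ∘ Equiv.swap i j = p then 1 else 0)
      else if ν i = ν j then (if ν = p then t else 0)
      else (if ν ∘ Equiv.swap i j = p then t else 0) + (if ν = p then t - 1 else 0) := by
  by_cases h1 : ν j < ν i
  · rw [if_pos h1]
    obtain ⟨m, hm⟩ : ∃ m, ν i = ν j + m + 1 := ⟨ν i - ν j - 1, by omega⟩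
    have e1 : ν = line ν i j (ν j + m + 1) (ν j) := by rw [← hm, line_self]
    have e2 : ν ∘ Equiv.swap i j = line ν i j (ν j) (ν j + m + 1) := by rw [← hm, line_swap _ hij]
    conv_lhs => rw [e1]
    rw [TG_mm_gt t hij, coeff_add, coeff_C_mul, coeff_inner_sum hij, ← e2, coeff_mm]
    · simp
    · rwa [← e1]
    · rw [← e2]; intro h5; apply h
      obtain ⟨a1, a2, a3⟩ := h5
      refine ⟨?_, ?_, ?_⟩
      · intro k hk1 hk2; rw [a1 k hk1 hk2]; simp [Equiv.swap_apply_of_ne_of_ne hk1 hk2]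
      · simp at a2; omega
      · simp only [Function.comp, Equiv.swap_apply_left, Equiv.swap_apply_right] at a3
        rwa [max_comm (ν i)]
  rw [if_neg h1]
  by_cases h2 : ν i = ν j
  · rw [if_pos h2]
    rw [TG_sym t hij, coeff_C_mul, coeff_mm]
    · simp
    · rw [rename_mm]; congr 1; funext k
      simp only [Function.comp, Equiv.symm_swap]
      by_cases h3 : k = i
      · subst h3; simp [h2]
      · by_cases h4 : k = j
        · subst h4; simp [h2]
        · rw [Equiv.swap_apply_of_ne_of_ne h3 h4]
  rw [if_neg h2]
  obtain ⟨m, hm⟩ : ∃ m, ν j = ν i + m + 1 := ⟨ν j - ν i - 1, by omega⟩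
  have e1 : ν = line ν i j (ν i) (ν i + m + 1) := by rw [← hm, line_self]
  have e2 : ν ∘ Equiv.swap i j = line ν i j (ν i + m + 1) (ν i) := by rw [← hm, line_swap _ hij]
  have key := TG_mm_gt t hij ν (ν i) m
  rw [← e1, ← e2] at key
  have hs : TG t i j (mm A ν + mm A (ν ∘ Equiv.swap i j)) =
      C t * (mm A ν + mm A (ν ∘ Equiv.swap i j)) := by
    apply TG_sym t hij
    rw [map_add, rename_mm, rename_mm, add_comm]
    congr 2
    funext k; simp
  rw [← TL_apply t hij, map_add, TL_apply, TL_apply, key] at hs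
  have hs2 : TG t i j (mm A ν) = C t * mm A (ν ∘ Equiv.swap i j) + C (t - 1) * mm A ν
      - C (1 - t) * ∑ k ∈ Finset.range m, mm A (line ν i j (ν i + k + 1) (ν i + (m - k))) := by
    simp only [map_sub, map_one] at hs ⊢
    linear_combination hs
  rw [hs2, coeff_sub, coeff_add]
  simp only [coeff_C_mul]
  rw [coeff_inner_sum hij, coeff_mm, coeff_mm]
  · simp
  · rw [← e2]; intro h5; apply h
    obtain ⟨a1, a2, a3⟩ := h5
    refine ⟨?_, ?_, ?_⟩
    · intro k hk1 hk2; rw [a1 k hk1 hk2]; simp [Equiv.swap_apply_of_ne_of_ne hk1 hk2]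
    · simp at a2; omega
    · simp only [Function.comp, Equiv.swap_apply_left, Equiv.swap_apply_right] at a3
      rwa [max_comm (ν i)]
  · rwa [← e1]

theorem coeff_TG (t : A) {i j : Fin n} (hij : i ≠ j) (f : MvPolynomial (Fin n) A) (p : Fin n → ℕ) :
    coeff (expOf p) (TG t i j f) =
      ∑ m ∈ f.support, coeff m f * coeff (expOf p) (TG t i j (mm A (⇑m))) := by
  conv_lhs => rw [f.as_sum, ← TL_apply t hij, map_sum, coeff_sum]
  apply Finset.sum_congr rfl
  intro m _
  have : monomial m (coeff m f) = coeff m f • mm A (⇑m) := by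
    unfold mm; rw [expOf_coe, smul_monomial]; simp
  rw [this, map_smul, coeff_smul, TL_apply, smul_eq_mul]

end generic
end IA

namespace IA
set_option linter.unusedSectionVars false

/-! ### the local ring at `q = 1` -/

abbrev Pol : Type := MvPolynomial (Fin 2) ℚ

theorem specQ1_X0 : specQ1 (X 0) = 1 := by
  unfold specQ1; simp

theorem specQ1_X1 : specQ1 (X 1) = t1 := by
  unfold specQ1; simp

/-- denominators regular at `q = 1` -/
def Mreg : Submonoid Pol := (nonZeroDivisors K1).comap specQ1

theorem mem_Mreg {b : Pol} : b ∈ Mreg ↔ specQ1 b ≠ 0 := by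
  unfold Mreg
  rw [Submonoid.mem_comap, mem_nonZeroDivisors_iff_ne_zero]

theorem Mreg_le : Mreg ≤ nonZeroDivisors Pol := by
  intro b hb
  rw [mem_nonZeroDivisors_iff_ne_zero]
  rintro rfl
  exact mem_Mreg.mp hb (map_zero _)

abbrev Rl : Type := Localization Mreg

instance : IsDomain Rl := IsLocalization.isDomain_localization Mreg_le

theorem algK_inj : Function.Injective (algebraMap Pol K) := IsFractionRing.injective Pol K

theorem isUnit_K (y : Mreg) : IsUnit (algebraMap Pol K y) := by
  rw [isUnit_iff_ne_zero]
  intro h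
  rw [map_eq_zero_iff _ algK_inj] at h
  have := mem_Mreg.mp y.2
  rw [h] at this
  exact this (map_zero _)

theorem isUnit_K1 (y : Mreg) : IsUnit (specQ1 y) := by
  rw [isUnit_iff_ne_zero]
  exact mem_Mreg.mp y.2

/-- inclusion in `K` -/
def iK : Rl →+* K := IsLocalization.lift (M := Mreg) (g := algebraMap Pol K) isUnit_K
/-- specialization -/
def sp : Rl →+* K1 := IsLocalization.lift (M := Mreg) (g := specQ1) isUnit_K1

theorem iK_alg (a : Pol) : iK (algebraMap Pol Rl a) = algebraMap Pol K a :=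
  IsLocalization.lift_eq _ _
theorem sp_alg (a : Pol) : sp (algebraMap Pol Rl a) = specQ1 a :=
  IsLocalization.lift_eq _ _

theorem iK_inj : Function.Injective iK := by
  unfold iK
  rw [IsLocalization.lift_injective_iff]
  intro x y
  rw [algK_inj.eq_iff, (IsLocalization.injective Rl Mreg_le).eq_iff]

theorem reg_of_Rl (r : Rl) : RegAtQ1 (iK r) (sp r) := by
  obtain ⟨a, b, rfl⟩ := IsLocalization.exists_mk'_eq Mreg r
  have hb := mem_Mreg.mp b.2
  refine ⟨a, b, ?_, hb, ?_, ?_⟩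
  · intro h; rw [h] at hb; exact hb (map_zero _)
  · have h := congrArg iK (IsLocalization.mk'_spec Rl a b)
    rw [map_mul, iK_alg, iK_alg] at h
    exact eq_div_of_mul_eq (isUnit_K b).ne_zero h
  · have h := congrArg sp (IsLocalization.mk'_spec Rl a b)
    rw [map_mul, sp_alg, sp_alg] at h
    exact eq_div_of_mul_eq hb h

theorem isUnit_of_sp {r : Rl} (h : sp r ≠ 0) : IsUnit r := by
  obtain ⟨a, b, rfl⟩ := IsLocalization.exists_mk'_eq Mreg r
  have ha : specQ1 a ≠ 0 := by
    intro h0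
    apply h
    have h1 := IsLocalization.mk'_spec Rl a b
    have h2 := congrArg sp h1
    rw [map_mul, sp_alg, sp_alg, h0] at h2
    exact (mul_eq_zero.mp h2).resolve_right (mem_Mreg.mp b.2)
  rw [IsLocalization.mk'_eq_mul_mk'_one]
  apply IsUnit.mul
  · exact IsLocalization.map_units Rl (⟨a, mem_Mreg.mpr ha⟩ : Mreg)
  · refine IsUnit.of_mul_eq_one (algebraMap Pol Rl b) ?_
    rw [IsLocalization.mk'_spec, map_one]

/-- `c` is regular at `q=1` with value `v`. -/
def RgC (c : K) (v : K1) : Prop := ∃ r : Rl, iK r = c ∧ sp r = v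

theorem RgC.mul {a b : K} {v w : K1} (h1 : RgC a v) (h2 : RgC b w) : RgC (a * b) (v * w) := by
  obtain ⟨r, rfl, rfl⟩ := h1
  obtain ⟨s, rfl, rfl⟩ := h2
  exact ⟨r * s, map_mul _ _ _, map_mul _ _ _⟩

theorem RgC.sub {a b : K} {v w : K1} (h1 : RgC a v) (h2 : RgC b w) : RgC (a - b) (v - w) := by
  obtain ⟨r, rfl, rfl⟩ := h1
  obtain ⟨s, rfl, rfl⟩ := h2
  exact ⟨r - s, map_sub _ _ _, map_sub _ _ _⟩

theorem RgC.pow {a : K} {v : K1} (h1 : RgC a v) (k : ℕ) : RgC (a ^ k) (v ^ k) := by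
  obtain ⟨r, rfl, rfl⟩ := h1
  exact ⟨r ^ k, map_pow _ _ _, map_pow _ _ _⟩

theorem RgC.one : RgC 1 1 := ⟨1, map_one _, map_one _⟩

theorem RgC.inv {a : K} {v : K1} (h1 : RgC a v) (hv : v ≠ 0) : RgC a⁻¹ v⁻¹ := by
  obtain ⟨r, rfl, rfl⟩ := h1
  obtain ⟨u, rfl⟩ := isUnit_of_sp hv
  refine ⟨↑u⁻¹, ?_, ?_⟩
  · apply eq_inv_of_mul_eq_one_left
    rw [← map_mul]; simp
  · apply eq_inv_of_mul_eq_one_left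
    rw [← map_mul]; simp

theorem RgC.qq : RgC qq 1 := ⟨algebraMap Pol Rl (X 0), by rw [iK_alg]; rfl, by
  rw [sp_alg, specQ1_X0]⟩

theorem RgC.tt : RgC tt t1 := ⟨algebraMap Pol Rl (X 1), by rw [iK_alg]; rfl, by
  rw [sp_alg, specQ1_X1]⟩

theorem RgC.unique {a : K} {v w : K1} (h1 : RgC a v) (h2 : RgC a w) : v = w := by
  obtain ⟨r, h1, rfl⟩ := h1
  obtain ⟨s, h2, rfl⟩ := h2
  rw [iK_inj (h1.trans h2.symm)]

/-- regular polynomials -/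
def Rg {n : ℕ} (f : MvPolynomial (Fin n) K) (g : MvPolynomial (Fin n) K1) : Prop :=
  ∃ F : MvPolynomial (Fin n) Rl, map iK F = f ∧ map sp F = g

section Rg
variable {n : ℕ} {f f' : MvPolynomial (Fin n) K} {g g' : MvPolynomial (Fin n) K1}

theorem Rg.unique (h : Rg f g) (h' : Rg f g') : g = g' := by
  obtain ⟨F, h1, rfl⟩ := h
  obtain ⟨G, h2, rfl⟩ := h'
  rw [map_injective iK iK_inj (h1.trans h2.symm)]

theorem Rg.add (h : Rg f g) (h' : Rg f' g') : Rg (f + f') (g + g') := by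
  obtain ⟨F, rfl, rfl⟩ := h
  obtain ⟨G, rfl, rfl⟩ := h'
  exact ⟨F + G, map_add _ _ _, map_add _ _ _⟩

theorem Rg.sub (h : Rg f g) (h' : Rg f' g') : Rg (f - f') (g - g') := by
  obtain ⟨F, rfl, rfl⟩ := h
  obtain ⟨G, rfl, rfl⟩ := h'
  exact ⟨F - G, map_sub _ _ _, map_sub _ _ _⟩

theorem Rg.mul (h : Rg f g) (h' : Rg f' g') : Rg (f * f') (g * g') := by
  obtain ⟨F, rfl, rfl⟩ := h
  obtain ⟨G, rfl, rfl⟩ := h'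
  exact ⟨F * G, map_mul _ _ _, map_mul _ _ _⟩

theorem Rg.C {a : K} {v : K1} (h : RgC a v) : Rg (C a : MvPolynomial (Fin n) K) (C v) := by
  obtain ⟨r, rfl, rfl⟩ := h
  exact ⟨MvPolynomial.C r, map_C _ _, map_C _ _⟩

theorem Rg.X (i : Fin n) : Rg (X i) (X i) := ⟨MvPolynomial.X i, map_X _ _, map_X _ _⟩

theorem Rg.one : Rg (1 : MvPolynomial (Fin n) K) 1 := ⟨1, map_one _, map_one _⟩

theorem Rg.prod {ι : Type*} (s : Finset ι) {F : ι → MvPolynomial (Fin n) K}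
    {G : ι → MvPolynomial (Fin n) K1} (h : ∀ i ∈ s, Rg (F i) (G i)) :
    Rg (∏ i ∈ s, F i) (∏ i ∈ s, G i) := by
  induction s using Finset.induction_on with
  | empty => simpa using Rg.one
  | insert a s ha ih =>
    rw [Finset.prod_insert ha, Finset.prod_insert ha]
    exact (h a (Finset.mem_insert_self _ _)).mul (ih fun i hi => h i (Finset.mem_insert_of_mem hi))

theorem Rg.sum {ι : Type*} (s : Finset ι) {F : ι → MvPolynomial (Fin n) K}
    {G : ι → MvPolynomial (Fin n) K1} (h : ∀ i ∈ s, Rg (F i) (G i)) :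
    Rg (∑ i ∈ s, F i) (∑ i ∈ s, G i) := by
  induction s using Finset.induction_on with
  | empty => exact ⟨0, by simp, by simp⟩
  | insert a s ha ih =>
    rw [Finset.sum_insert ha, Finset.sum_insert ha]
    exact (h a (Finset.mem_insert_self _ _)).add (ih fun i hi => h i (Finset.mem_insert_of_mem hi))

theorem Rg.TG (h : Rg f g) {i j : Fin n} (hij : i ≠ j) : Rg (TG tt i j f) (TG t1 i j g) := by
  obtain ⟨F, rfl, rfl⟩ := h
  obtain ⟨r, hr1, hr2⟩ := RgC.tt
  refine ⟨IA.TG r i j F, ?_, ?_⟩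
  · rw [TG_map _ _ hij, hr1]
  · rw [TG_map _ _ hij, hr2]

theorem Rg.coeff (h : Rg f g) (m : Fin n →₀ ℕ) : RgC (coeff m f) (coeff m g) := by
  obtain ⟨F, rfl, rfl⟩ := h
  exact ⟨MvPolynomial.coeff m F, (coeff_map _ _ _).symm, (coeff_map _ _ _).symm⟩

/-- substitution -/
theorem Rg.aeval (h : Rg f g) {φ : Fin n → MvPolynomial (Fin n) K}
    {ψ : Fin n → MvPolynomial (Fin n) K1} (hφ : ∀ i, Rg (φ i) (ψ i)) :
    Rg (aeval φ f) (aeval ψ g) := by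
  obtain ⟨F, rfl, rfl⟩ := h
  choose G h1 h2 using hφ
  refine ⟨MvPolynomial.aeval G F, ?_, ?_⟩
  · induction F using MvPolynomial.induction_on with
    | C a => simp
    | add p q hp hq => rw [map_add, map_add, map_add, map_add, hp, hq]
    | mul_X p i hp =>
      rw [map_mul, map_mul, map_mul, map_mul, hp, map_X, aeval_X, aeval_X, h1]
  · induction F using MvPolynomial.induction_on with
    | C a => simp
    | add p q hp hq => rw [map_add, map_add, map_add, map_add, hp, hq]
    | mul_X p i hp =>
      rw [map_mul, map_mul, map_mul, map_mul, hp, map_X, aeval_X, aeval_X, h2]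

end Rg

/-! ### powers of `q` and `t` -/

theorem qq_ne : qq ≠ 0 := by
  unfold qq; rw [Ne, map_eq_zero_iff _ algK_inj]; exact X_ne_zero 0

theorem tt_ne : tt ≠ 0 := by
  unfold tt; rw [Ne, map_eq_zero_iff _ algK_inj]; exact X_ne_zero 1

theorem qt_ne (a b c : ℕ) (ha : 0 < a) : qq ^ a * tt ^ b ≠ tt ^ c := by
  unfold qq tt
  intro h
  rw [← map_pow, ← map_pow, ← map_pow, ← map_mul] at h
  have h2 := algK_inj h
  have h3 := congrArg (eval (fun i : Fin 2 => if i = 0 then (0 : ℚ) else 1)) h2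
  simp [ha.ne'] at h3

theorem t1_ne : t1 ≠ 0 := by
  unfold t1
  rw [Ne, map_eq_zero_iff _ (IsFractionRing.injective (Polynomial ℚ) K1)]
  exact Polynomial.X_ne_zero

theorem t1_pow_ne (b : ℕ) (hb : 0 < b) : t1 ^ b - 1 ≠ 0 := by
  rw [sub_ne_zero]
  unfold t1
  rw [← map_pow, ← map_one (algebraMap (Polynomial ℚ) K1)]
  intro h
  have h2 := IsFractionRing.injective (Polynomial ℚ) K1 h
  have h3 := congrArg (Polynomial.eval 0) h2
  simp [hb.ne'] at h3

theorem tt_ne_one : tt ≠ 1 := by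
  intro h
  have h1 : RgC 1 t1 := h ▸ RgC.tt
  have h2 := h1.unique RgC.one
  exact t1_pow_ne 1 one_pos (by rw [h2]; simp)

theorem qt_zpow_ne (a : ℕ) (b c : ℕ) (ha : 0 < a) (d : ℕ) :
    qq ^ (d + a) * tt ^ (-(b : ℤ)) ≠ qq ^ d * tt ^ (-(c : ℤ)) := by
  intro h
  have h1 : qq ^ a * tt ^ c = tt ^ b := by
    rw [zpow_neg, zpow_neg, zpow_natCast, zpow_natCast] at h
    have := tt_ne
    have := qq_ne
    field_simp at h
    rw [pow_add] at h
    have h5 : qq ^ d ≠ 0 := pow_ne_zero _ qq_ne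
    apply mul_left_cancel₀ h5
    linear_combination h
  exact qt_ne a c b ha h1

end IA

namespace IA
set_option linter.unusedSectionVars false

/-- position `j` beats position `i` -/
def Bt {n : ℕ} (ν : Fin n → ℕ) (i j : Fin n) : Prop := ν i < ν j ∨ (ν i = ν j ∧ i < j)

theorem kstat_eq {n : ℕ} (ν : Fin n → ℕ) (i : Fin n) :
    kstat ν i = (Finset.univ.filter (fun j => Bt ν i j)).card := by
  unfold kstat
  have h1 : {j : Fin n | j < i ∧ ν i < ν j} =
      ↑(Finset.univ.filter (fun j : Fin n => j < i ∧ ν i < ν j)) := by ext; simp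
  have h2 : {j : Fin n | i < j ∧ ν i ≤ ν j} =
      ↑(Finset.univ.filter (fun j : Fin n => i < j ∧ ν i ≤ ν j)) := by ext; simp
  rw [h1, h2, Set.ncard_coe_finset, Set.ncard_coe_finset, ← Finset.card_union_of_disjoint]
  · congr 1
    ext j
    simp only [Finset.mem_union, Finset.mem_filter, Finset.mem_univ, true_and]
    unfold Bt
    rcases lt_trichotomy i j with h | h | h
    · constructor
      · rintro (⟨h3, _⟩ | ⟨_, h3⟩)
        · omega
        · rcases h3.lt_or_eq with h4 | h4 <;> simp [h4, h]
      · rintro (h3 | ⟨h3, _⟩)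
        · right; exact ⟨h, h3.le⟩
        · right; exact ⟨h, h3.le⟩
    · subst h; simp
    · simp [h, h.not_gt]
  · rw [Finset.disjoint_filter]
    intro j _ h3 h4
    omega

theorem kstat_emb {m n : ℕ} (e : Fin m ↪ Fin n) (ν : Fin n → ℕ) (ν' : Fin m → ℕ) (a : Fin m)
    (h1 : ∀ b, Bt ν (e a) b → b ∈ Set.range e) (h2 : ∀ b, Bt ν (e a) (e b) ↔ Bt ν' a b) :
    kstat ν (e a) = kstat ν' a := by
  rw [kstat_eq, kstat_eq, ← Finset.card_map e]
  congr 1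
  ext b
  simp only [Finset.mem_filter, Finset.mem_univ, true_and, Finset.mem_map]
  constructor
  · intro h
    obtain ⟨c, rfl⟩ := h1 b h
    exact ⟨c, (h2 c).mp h, rfl⟩
  · rintro ⟨c, hc, rfl⟩
    exact (h2 c).mpr hc

theorem kstat_perm {n : ℕ} (ρ : Equiv.Perm (Fin n)) (ν ν' : Fin n → ℕ)
    (h2 : ∀ a b, Bt ν (ρ a) (ρ b) ↔ Bt ν' a b) (a : Fin n) :
    kstat ν (ρ a) = kstat ν' a :=
  kstat_emb ρ.toEmbedding ν ν' a (fun b _ => ⟨ρ.symm b, by simp⟩) (h2 a)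

theorem kstat_lt {n : ℕ} (ν : Fin n → ℕ) {i j : Fin n} (h : Bt ν i j) : kstat ν j < kstat ν i := by
  rw [kstat_eq, kstat_eq]
  apply Finset.card_lt_card
  rw [Finset.ssubset_iff_of_subset]
  · refine ⟨j, by simpa using h, ?_⟩
    simp only [Finset.mem_filter, Finset.mem_univ, true_and]
    unfold Bt; omega
  · intro b
    simp only [Finset.mem_filter, Finset.mem_univ, true_and]
    unfold Bt at *
    omega

theorem kstat_adj {n : ℕ} (ν : Fin n → ℕ) {i j : Fin n} (hij : i.val + 1 = j.val)
    (h : ν i = ν j) : kstat ν i = kstat ν j + 1 := by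
  rw [kstat_eq, kstat_eq]
  have : Finset.univ.filter (fun b => Bt ν i b) = insert j (Finset.univ.filter (fun b => Bt ν j b)) := by
    ext b
    simp only [Finset.mem_filter, Finset.mem_univ, true_and, Finset.mem_insert]
    unfold Bt
    simp only [Fin.ext_iff, Fin.lt_def]
    by_cases hb : b.val = j.val
    · have : b = j := Fin.ext hb
      subst this; omega
    · omega
  rw [this, Finset.card_insert_of_notMem]
  simp only [Finset.mem_filter, Finset.mem_univ, true_and]
  unfold Bt; omega

theorem kstat_of_all {n : ℕ} (ν : Fin n → ℕ) (i : Fin n) (h : ∀ j, j ≠ i → Bt ν i j) :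
    kstat ν i = n - 1 := by
  rw [kstat_eq]
  have : Finset.univ.filter (fun b => Bt ν i b) = Finset.univ.erase i := by
    ext b
    simp only [Finset.mem_filter, Finset.mem_univ, true_and, Finset.mem_erase, and_true]
    constructor
    · rintro h rfl; simp [Bt] at h
    · exact h b
  rw [this, Finset.card_erase_of_mem (Finset.mem_univ _)]; simp

/-- antidominant compositions -/
theorem kstat_mono {n : ℕ} (ν : Fin n → ℕ) (h : ∀ a b : Fin n, a ≤ b → ν a ≤ ν b) {i j : Fin n}
    (hij : i.val + 1 = j.val) : kstat ν i = kstat ν j + 1 := by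
  have key : ∀ a b, Bt ν a b ↔ Bt (fun _ => 0) a b := by
    intro a b
    unfold Bt
    simp only [lt_irrefl, true_and, false_or]
    constructor
    · intro h1
      by_contra h2
      have := h b a (not_lt.mp h2)
      omega
    · intro h1
      have := h a b h1.le
      omega
  have e : ∀ a, kstat ν a = kstat (fun _ : Fin n => 0) a := kstat_perm (Equiv.refl _) _ _ key
  rw [e, e]
  exact kstat_adj _ hij rfl

/-! swapping -/

theorem evalPt_swap {n : ℕ} (ν : Fin n → ℕ) {i j : Fin n} (hij : i.val + 1 = j.val)
    (h : ν i ≠ ν j) : evalPt ν ∘ Equiv.swap i j = evalPt (ν ∘ Equiv.swap i j) := by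
  have hk : ∀ a, kstat ν (Equiv.swap i j a) = kstat (ν ∘ Equiv.swap i j) a := by
    apply kstat_perm
    intro a b
    have hne : i ≠ j := by intro h; subst h; omega
    unfold Bt
    simp only [Function.comp]
    have key : ν (Equiv.swap i j a) = ν (Equiv.swap i j b) →
        (Equiv.swap i j a < Equiv.swap i j b ↔ a < b) := by
      intro hab
      rw [Equiv.swap_apply_def, Equiv.swap_apply_def] at hab ⊢
      split_ifs at hab ⊢ with h1 h2 h3 h4 h5 h6 h7
      all_goals first
        | (exfalso; exact h hab)
        | (exfalso; exact h hab.symm)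
        | (simp only [Fin.ext_iff, Fin.lt_def] at * <;> omega)
    constructor
    · rintro (h1 | ⟨h1, h2⟩)
      · exact Or.inl h1
      · exact Or.inr ⟨h1, (key h1).mp h2⟩
    · rintro (h1 | ⟨h1, h2⟩)
      · exact Or.inl h1
      · exact Or.inr ⟨h1, (key h1).mpr h2⟩
  funext a
  simp only [Function.comp, evalPt, hk]

theorem evalPt_ne {n : ℕ} (ν : Fin n → ℕ) {i j : Fin n} (h : ν j < ν i) :
    evalPt ν i ≠ evalPt ν j := by
  unfold evalPt
  obtain ⟨a, ha⟩ : ∃ a, ν i = ν j + a := ⟨ν i - ν j, by omega⟩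
  rw [ha]
  exact qt_zpow_ne a _ _ (by omega) _

theorem evalPt_eq {n : ℕ} (ν : Fin n → ℕ) {i j : Fin n} (hij : i.val + 1 = j.val) (h : ν i = ν j) :
    evalPt ν j = tt * evalPt ν i := by
  unfold evalPt
  rw [h, kstat_adj ν hij h]
  have := tt_ne
  push_cast
  rw [neg_add, zpow_add₀ tt_ne, zpow_neg_one]
  field_simp

theorem evalPt_ne_zero {n : ℕ} (ν : Fin n → ℕ) (i : Fin n) : evalPt ν i ≠ 0 :=
  mul_ne_zero (pow_ne_zero _ qq_ne) (zpow_ne_zero _ tt_ne)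

/-- evaluation of `T_i f` when entries are equal -/
theorem eval_T_eq {n : ℕ} (ν : Fin n → ℕ) {i j : Fin n} (hij : i.val + 1 = j.val) (h : ν i = ν j)
    (f : MvPolynomial (Fin n) K) :
    eval (evalPt ν) (TG tt i j f) = tt * eval (evalPt ν) f := by
  have h1 := TG_eval tt i j f (evalPt ν)
  rw [evalPt_eq ν hij h] at h1
  have h2 : (1 - tt) * evalPt ν i ≠ 0 :=
    mul_ne_zero (sub_ne_zero.mpr tt_ne_one.symm) (evalPt_ne_zero _ _)
  apply mul_left_cancel₀ h2
  linear_combination h1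

theorem eval_T_zero {n : ℕ} (ν : Fin n → ℕ) {i j : Fin n} (hij : i.val + 1 = j.val)
    (f : MvPolynomial (Fin n) K) (h1 : eval (evalPt ν) f = 0)
    (h2 : ν i ≠ ν j → eval (evalPt (ν ∘ Equiv.swap i j)) f = 0) :
    eval (evalPt ν) (TG tt i j f) = 0 := by
  by_cases h : ν i = ν j
  · rw [eval_T_eq ν hij h, h1, mul_zero]
  · have h3 := TG_eval tt i j f (evalPt ν)
    rw [evalPt_swap ν hij h, h1, h2 h, mul_zero, mul_zero, add_zero] at h3
    refine (mul_eq_zero.mp h3).resolve_left ?_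
    rw [← Ne, sub_ne_zero]
    rcases lt_or_gt_of_ne h with h4 | h4
    · exact (evalPt_ne ν h4).symm
    · exact evalPt_ne ν h4

/-! cyclic shifts -/

/-- cyclic shift by `l`: moves the first `l` positions to the end. -/
def cyc {n : ℕ} (l : ℕ) (h : l ≤ n) : Equiv.Perm (Fin n) where
  toFun i := ⟨if i.val < l then i.val + (n - l) else i.val - l, by have := i.2; split <;> omega⟩
  invFun k := ⟨if k.val < n - l then k.val + l else k.val - (n - l), by
    have := k.2; split <;> omega⟩
  left_inv i := by
    have := i.2
    apply Fin.ext
    by_cases h1 : i.val < l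
    · simp only [h1, if_true]; rw [if_neg (by omega)]; omega
    · simp only [h1, if_false]; rw [if_pos (by omega)]; omega
  right_inv k := by
    have := k.2
    apply Fin.ext
    by_cases h1 : k.val < n - l
    · simp only [h1, if_true]; rw [if_neg (by omega)]; omega
    · simp only [h1, if_false]; rw [if_pos (by omega)]; omega

theorem cyc_lt {n l : ℕ} (h : l ≤ n) {i : Fin n} (hi : i.val < l) :
    (cyc l h i).val = i.val + (n - l) := by simp [cyc, hi]

theorem cyc_ge {n l : ℕ} (h : l ≤ n) {i : Fin n} (hi : ¬ i.val < l) :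
    (cyc l h i).val = i.val - l := by simp [cyc, hi]

/-- the composition obtained by adding a column -/
def up {n : ℕ} (l : ℕ) (h : l ≤ n) (ν : Fin n → ℕ) : Fin n → ℕ :=
  fun i => if i.val < l then ν (cyc l h i) + 1 else ν (cyc l h i)

theorem exists_up {n l : ℕ} (h : l ≤ n) (ν : Fin n → ℕ) (hν : ∀ i : Fin n, i.val < l → 0 < ν i) :
    ∃ ν', ν = up l h ν' := by
  refine ⟨fun k => if ((cyc l h).symm k).val < l then ν ((cyc l h).symm k) - 1
    else ν ((cyc l h).symm k), ?_⟩
  funext i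
  unfold up
  by_cases hi : i.val < l
  · have := hν i hi
    simp [hi]; omega
  · simp [hi]

theorem up_inj {n l : ℕ} (h : l ≤ n) {ν ν' : Fin n → ℕ} (e : up l h ν = up l h ν') : ν = ν' := by
  funext k
  have := congrFun e ((cyc l h).symm k)
  unfold up at this
  split_ifs at this <;> simpa using this

theorem sum_ind {n l : ℕ} (h : l ≤ n) : (∑ i : Fin n, if i.val < l then 1 else 0) = l := by
  rw [Finset.sum_boole]
  simp only [Nat.cast_id]
  rw [Fin.card_filter_val_lt]
  omega

theorem csize_up {n l : ℕ} (h : l ≤ n) (ν : Fin n → ℕ) : csize (up l h ν) = csize ν + l := by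
  have e : ∀ i, up l h ν i = ν (cyc l h i) + if i.val < l then 1 else 0 := by
    intro i; unfold up; split_ifs <;> rfl
  unfold csize
  simp only [e]
  rw [Finset.sum_add_distrib, sum_ind h, Equiv.sum_comp (cyc l h) ν]

theorem evalPt_up {n l : ℕ} (h : l ≤ n) (ν : Fin n → ℕ) (i : Fin n) :
    evalPt (up l h ν) i = (if i.val < l then qq else 1) * evalPt ν (cyc l h i) := by
  have hk : ∀ a, kstat ν (cyc l h a) = kstat (up l h ν) a := by
    apply kstat_perm
    intro a b
    unfold Bt up
    simp only [Fin.lt_def]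
    by_cases ha : a.val < l <;> by_cases hb : b.val < l
    · simp only [ha, hb, if_true, cyc_lt h ha, cyc_lt h hb]; omega
    · have := b.2
      simp only [ha, hb, if_true, if_false, cyc_lt h ha, cyc_ge h hb]; omega
    · have := a.2
      simp only [ha, hb, if_true, if_false, cyc_ge h ha, cyc_lt h hb]; omega
    · simp only [ha, hb, if_false, cyc_ge h ha, cyc_ge h hb]; omega
  unfold evalPt
  rw [hk]
  unfold up
  split_ifs
  · rw [pow_succ]; ring
  · ring

theorem evalPt_zero {n l : ℕ} (h : l ≤ n) (ν : Fin n → ℕ)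
    (hν : ¬ ∀ i : Fin n, i.val < l → 0 < ν i) :
    ∃ i : Fin n, i.val < l ∧ evalPt ν i = tt ^ (-((n - 1 : ℕ) : ℤ)) := by
  push Not at hν
  obtain ⟨i0, h1, h2⟩ := hν
  have hne : (Finset.univ.filter (fun i : Fin n => ν i = 0)).Nonempty :=
    ⟨i0, by simp; omega⟩
  have hm := Finset.min'_mem _ hne
  have hle : ∀ b, ν b = 0 → (Finset.univ.filter (fun i : Fin n => ν i = 0)).min' hne ≤ b := by
    intro b hb
    exact Finset.min'_le _ _ (by simpa using hb)
  set i := (Finset.univ.filter (fun i : Fin n => ν i = 0)).min' hne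
  simp only [Finset.mem_filter, Finset.mem_univ, true_and] at hm
  refine ⟨i, ?_, ?_⟩
  · have := hle i0 (by omega)
    rw [Fin.le_def] at this; omega
  · unfold evalPt
    rw [hm, kstat_of_all ν i]
    · simp
    · intro b hb
      unfold Bt
      by_cases h0 : ν b = 0
      · right; exact ⟨by omega, lt_of_le_of_ne (hle b h0) hb.symm⟩
      · left; omega

/-! uniqueness -/

theorem eval_aeval {m n : ℕ} {A : Type*} [CommRing A] (φ : Fin m → MvPolynomial (Fin n) A)
    (y : Fin n → A) (f : MvPolynomial (Fin m) A) :
    eval y (aeval φ f) = eval (fun i => eval y (φ i)) f := by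
  induction f using MvPolynomial.induction_on with
  | C a => simp
  | add p q hp hq => rw [map_add, map_add, map_add, hp, hq]
  | mul_X p i hp => rw [map_mul, map_mul, map_mul, hp, aeval_X, eval_X]

theorem totalDegree_aeval_le {m n : ℕ} (φ : Fin m → MvPolynomial (Fin n) K)
    (hφ : ∀ i, (φ i).totalDegree ≤ 1) (f : MvPolynomial (Fin m) K) :
    (aeval φ f).totalDegree ≤ f.totalDegree := by
  rw [aeval_def, eval₂_eq]
  apply totalDegree_finsetSum_le
  intro d hd
  refine (totalDegree_mul _ _).trans ?_
  have h1 : ((algebraMap K (MvPolynomial (Fin n) K)) (coeff d f)).totalDegree = 0 :=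
    totalDegree_C _
  rw [h1, zero_add]
  refine (totalDegree_finsetProd _ _).trans ?_
  refine le_trans ?_ (le_totalDegree hd)
  rw [Finsupp.sum]
  apply Finset.sum_le_sum
  intro i _
  refine (totalDegree_pow _ _).trans ?_
  calc d i * (φ i).totalDegree ≤ d i * 1 := Nat.mul_le_mul_left _ (hφ i)
    _ = d i := mul_one _

theorem evalPt_cons {n : ℕ} (ν : Fin n → ℕ) :
    evalPt (Fin.cons 0 ν : Fin (n + 1) → ℕ) = Fin.cons (tt ^ (-(n : ℤ))) (evalPt ν) := by
  funext i
  refine Fin.cases ?_ (fun i => ?_) i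
  · unfold evalPt
    rw [kstat_of_all]
    · simp
    · intro j hj
      unfold Bt
      simp only [Fin.cons_zero]
      have := Fin.pos_of_ne_zero hj
      omega
  · simp only [Fin.cons_succ]
    unfold evalPt
    have := kstat_emb (Fin.succEmb n) (Fin.cons 0 ν : Fin (n + 1) → ℕ) ν i (by
      intro b
      refine Fin.cases ?_ (fun b => ?_) b
      · intro hb
        simp [Bt] at hb
      · intro _; exact ⟨b, rfl⟩) (by
      intro b
      simp [Bt])
    rw [Fin.coe_succEmb] at this
    rw [this]; simp

theorem uniq (n : ℕ) : ∀ (d : ℕ) (f : MvPolynomial (Fin n) K), f.totalDegree ≤ d →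
    (∀ ν, csize ν ≤ d → eval (evalPt ν) f = 0) → f = 0 := by
  induction n with
  | zero =>
    intro d f _ h
    have h0 := h (fun _ => 0) (by simp [csize])
    rw [eq_C_of_isEmpty f] at h0 ⊢
    rw [eval_C] at h0
    rw [h0, C_0]
  | succ n ihn =>
    intro d
    induction d with
    | zero =>
      intro f hf h
      have h0 := h (fun _ => 0) (by simp [csize])
      rw [totalDegree_eq_zero_iff_eq_C.mp (Nat.le_zero.mp hf)] at h0 ⊢
      rw [eval_C] at h0
      rw [h0, C_0]
    | succ d ihd =>
      intro f hf h
      set a : K := tt ^ (-(n : ℤ)) with ha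
      set φ : Fin (n + 1) → MvPolynomial (Fin n) K := Fin.cons (C a) X with hφ
      have h1 : aeval φ f = 0 := by
        apply ihn (d + 1)
        · refine (totalDegree_aeval_le φ ?_ f).trans hf
          intro i
          refine Fin.cases ?_ (fun i => ?_) i
          · simp [hφ]
          · simp [hφ]
        · intro ν hν
          have := h (Fin.cons 0 ν) (by simpa [csize, Fin.sum_univ_succ] using hν)
          rw [evalPt_cons] at this
          rw [← this]
          change (eval (evalPt ν)) (aeval φ f) = _
          rw [eval_aeval]
          congr 2
          funext i
          refine Fin.cases ?_ (fun i => ?_) i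
          · simp [hφ, ha]
          · simp [hφ]
      have h2 : (X 0 - C a) ∣ f := by
        have := dvd_sub_of_gens (RingHom.id (MvPolynomial (Fin (n + 1)) K))
          ((rename Fin.succ).comp (aeval φ) : MvPolynomial (Fin (n + 1)) K →ₐ[K] _).toRingHom
          (X 0 - C a) (by intro a; simp) (by
            intro i
            refine Fin.cases ?_ (fun i => ?_) i
            · simp [hφ]
            · simp [hφ]) f
        change (X 0 - C a) ∣ f - rename Fin.succ (aeval φ f) at this
        rw [h1, map_zero, sub_zero] at this
        exact this
      obtain ⟨g, rfl⟩ := h2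
      by_cases hg : g = 0
      · rw [hg, mul_zero]
      have hXc : ∀ c : K, (X 0 - C a : MvPolynomial (Fin (n + 1)) K) ≠ C c := by
        intro c h0
        have e0 := congrArg (eval (fun _ => (0 : K))) h0
        have e1 := congrArg (eval (fun _ => (1 : K))) h0
        simp only [map_sub, eval_X, eval_C] at e0 e1
        have : (1 : K) = 0 := by linear_combination e1 - e0
        exact one_ne_zero this
      have hX : (X 0 - C a : MvPolynomial (Fin (n + 1)) K) ≠ 0 := by
        intro h0
        exact hXc 0 (by rw [h0, C_0])
      have hXd : 1 ≤ (X 0 - C a : MvPolynomial (Fin (n + 1)) K).totalDegree := by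
        by_contra h0
        have h0 : (X 0 - C a : MvPolynomial (Fin (n + 1)) K).totalDegree = 0 := by omega
        exact hXc _ (totalDegree_eq_zero_iff_eq_C.mp h0)
      rw [totalDegree_mul_of_isDomain hX hg] at hf
      have hl : 1 ≤ n + 1 := by omega
      set ψ : Fin (n + 1) → MvPolynomial (Fin (n + 1)) K :=
        fun i => C (if i.val < 1 then qq else 1) * X (cyc 1 hl i) with hψ
      have h3 : aeval ψ g = 0 := by
        apply ihd
        · refine (totalDegree_aeval_le ψ ?_ g).trans (by omega)
          intro i
          refine (totalDegree_mul _ _).trans ?_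
          rw [totalDegree_C, totalDegree_X]
        · intro ν hν
          have h4 := h (up 1 hl ν) (by rw [csize_up]; omega)
          rw [map_mul] at h4
          have h5 : eval (evalPt ν) (aeval ψ g) = eval (evalPt (up 1 hl ν)) g := by
            rw [eval_aeval]
            congr 2
            funext i
            rw [evalPt_up, hψ]
            simp
          rw [h5]
          refine (mul_eq_zero.mp h4).resolve_left ?_
          rw [map_sub, eval_X, eval_C, ← Ne, sub_ne_zero, ha]
          have := qt_zpow_ne (up 1 hl ν 0) (kstat (up 1 hl ν) 0) n (by simp [up]) 0
          rw [pow_zero, one_mul, zero_add] at this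
          exact this
      have h6 : aeval (fun k => C (if ((cyc 1 hl).symm k).val < 1 then qq⁻¹ else 1) *
          X ((cyc 1 hl).symm k) : Fin (n + 1) → MvPolynomial (Fin (n + 1)) K) (aeval ψ g) = g := by
        have : ((aeval (fun k => C (if ((cyc 1 hl).symm k).val < 1 then qq⁻¹ else 1) *
          X ((cyc 1 hl).symm k) : Fin (n + 1) → MvPolynomial (Fin (n + 1)) K)).comp (aeval ψ)) =
            AlgHom.id K _ := by
          apply MvPolynomial.algHom_ext
          intro i
          simp only [AlgHom.comp_apply, aeval_X, hψ, map_mul, AlgHom.id_apply,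
            Equiv.symm_apply_apply]
          rw [← algebraMap_eq, AlgHom.commutes, algebraMap_eq, ← mul_assoc, ← C_mul]
          split_ifs
          · rw [mul_inv_cancel₀ qq_ne, C_1, one_mul]
          · rw [mul_one, C_1, one_mul]
        exact congrArg (fun F => F g) this
      rw [h3, map_zero] at h6
      rw [← h6, mul_zero]

end IA

namespace IA
set_option linter.unusedSectionVars false

/-- same orbit -/
def Orb {n : ℕ} (μ ν : Fin n → ℕ) : Prop := ∃ σ : Equiv.Perm (Fin n), ν = μ ∘ σ

theorem Orb.refl {n : ℕ} (μ : Fin n → ℕ) : Orb μ μ := ⟨1, rfl⟩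
theorem Orb.symm {n : ℕ} {μ ν : Fin n → ℕ} (h : Orb μ ν) : Orb ν μ := by
  obtain ⟨σ, rfl⟩ := h
  exact ⟨σ.symm, by funext i; simp⟩
theorem Orb.trans {n : ℕ} {μ ν ρ : Fin n → ℕ} (h : Orb μ ν) (h' : Orb ν ρ) : Orb μ ρ := by
  obtain ⟨σ, rfl⟩ := h
  obtain ⟨τ, rfl⟩ := h'
  exact ⟨σ * τ, rfl⟩
theorem Orb.perm {n : ℕ} {μ ν : Fin n → ℕ} (h : Orb μ ν) (σ : Equiv.Perm (Fin n)) :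
    Orb μ (ν ∘ σ) := h.trans ⟨σ, rfl⟩

theorem Orb.sum {n : ℕ} {μ ν : Fin n → ℕ} (h : Orb μ ν) (F : ℕ → ℕ) :
    ∑ i, F (ν i) = ∑ i, F (μ i) := by
  obtain ⟨σ, rfl⟩ := h
  exact Equiv.sum_comp σ (fun i => F (μ i))

theorem Orb.csize {n : ℕ} {μ ν : Fin n → ℕ} (h : Orb μ ν) : csize ν = csize μ := h.sum id

/-- weak dominance -/
def Dom {n : ℕ} (μ ν : Fin n → ℕ) : Prop := ∀ c : ℕ, ∑ i, (ν i - c) ≤ ∑ i, (μ i - c)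

theorem Dom.left {n : ℕ} {μ μ' ν : Fin n → ℕ} (h : Orb μ μ') (hd : Dom μ ν) : Dom μ' ν := by
  intro c; rw [h.sum (fun x => x - c)]; exact hd c
theorem Dom.right {n : ℕ} {μ ν ν' : Fin n → ℕ} (h : Orb ν ν') (hd : Dom μ ν) : Dom μ ν' := by
  intro c; rw [h.sum (fun x => x - c)]; exact hd c

theorem Dom.csize {n : ℕ} {μ ν : Fin n → ℕ} (h : Dom μ ν) : csize ν ≤ csize μ := by
  have := h 0; simpa [_root_.csize] using this

theorem sum_two {n : ℕ} {i j : Fin n} (hij : i ≠ j) (F : Fin n → ℕ) :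
    ∑ k, F k = F i + F j + ∑ k ∈ (Finset.univ.erase i).erase j, F k := by
  rw [add_assoc, Finset.add_sum_erase _ F (by simp [hij.symm]), Finset.add_sum_erase _ F (by simp)]

theorem inner_sum {n : ℕ} {i j : Fin n} (hij : i ≠ j) {ν p : Fin n → ℕ} (h : Inner i j ν p)
    (c : ℕ) : ∃ r, ∑ k, (p k - c) = (p i - c) + (p j - c) + r ∧
      ∑ k, (ν k - c) = (ν i - c) + (ν j - c) + r := by
  refine ⟨∑ k ∈ (Finset.univ.erase i).erase j, (ν k - c), ?_, sum_two hij _⟩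
  rw [sum_two hij (fun k => p k - c)]
  congr 1
  apply Finset.sum_congr rfl
  intro k hk
  simp only [Finset.mem_erase, Finset.mem_univ, and_true] at hk
  rw [h.1 k hk.2 hk.1]

theorem dom_inner {n : ℕ} {i j : Fin n} (hij : i ≠ j) {μ ν p : Fin n → ℕ} (h : Inner i j ν p)
    (hd : Dom μ ν) : Dom μ p := by
  intro c
  obtain ⟨r, h1, h2⟩ := inner_sum hij h c
  have := hd c
  obtain ⟨_, h3, h4⟩ := h
  omega

theorem not_inner {n : ℕ} {i j : Fin n} (hij : i ≠ j) {μ ν p : Fin n → ℕ} (ho : Orb μ p)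
    (hd : Dom μ ν) : ¬ Inner i j ν p := by
  intro h
  obtain ⟨r, h1, h2⟩ := inner_sum hij h (max (ν i) (ν j) - 1)
  have h3 := hd (max (ν i) (ν j) - 1)
  have h4 := ho.sum (fun x => x - (max (ν i) (ν j) - 1))
  obtain ⟨_, h5, h6⟩ := h
  omega

/-- dominance support -/
def DS {n : ℕ} (μ : Fin n → ℕ) (f : MvPolynomial (Fin n) K) : Prop :=
  ∀ ν, coeff (expOf ν) f ≠ 0 → Dom μ ν

theorem DS.left {n : ℕ} {μ μ' : Fin n → ℕ} {f : MvPolynomial (Fin n) K} (h : Orb μ μ')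
    (hd : DS μ f) : DS μ' f := fun ν hν => (hd ν hν).left h

theorem DS.degree {n : ℕ} {μ : Fin n → ℕ} {f : MvPolynomial (Fin n) K} (h : DS μ f) :
    f.totalDegree ≤ csize μ := by
  unfold MvPolynomial.totalDegree
  apply Finset.sup_le
  intro m hm
  have := (h (⇑m) (by rw [expOf_coe]; exact mem_support_iff.mp hm)).csize
  rwa [Finsupp.sum_fintype _ _ (by simp)]

theorem DS.add {n : ℕ} {μ : Fin n → ℕ} {f g : MvPolynomial (Fin n) K} (h : DS μ f) (h' : DS μ g) :
    DS μ (f + g) := by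
  intro ν hν
  rw [coeff_add] at hν
  by_cases h1 : coeff (expOf ν) f = 0
  · exact h' ν (by intro h2; rw [h1, h2, add_zero] at hν; exact hν rfl)
  · exact h ν h1

theorem DS.Cmul {n : ℕ} {μ : Fin n → ℕ} {f : MvPolynomial (Fin n) K} (h : DS μ f) (c : K) :
    DS μ (C c * f) := by
  intro ν hν
  rw [coeff_C_mul] at hν
  exact h ν (right_ne_zero_of_mul hν)

theorem DS.T {n : ℕ} {μ : Fin n → ℕ} {f : MvPolynomial (Fin n) K} (h : DS μ f) {i j : Fin n}
    (hij : i ≠ j) : DS μ (TG tt i j f) := by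
  intro p hp
  rw [coeff_TG tt hij] at hp
  obtain ⟨m, hm, hm2⟩ := Finset.exists_ne_zero_of_sum_ne_zero hp
  have hd : Dom μ (⇑m) := h _ (by rw [expOf_coe]; exact mem_support_iff.mp hm)
  by_cases hI : Inner i j (⇑m) p
  · exact dom_inner hij hI hd
  have h2 := right_ne_zero_of_mul hm2
  rw [coeff_TG_mm tt hij _ _ hI] at h2
  by_cases h3 : (⇑m) = p
  · rw [← h3]; exact hd
  by_cases h4 : (⇑m) ∘ Equiv.swap i j = p
  · rw [← h4]; exact hd.right ⟨_, rfl⟩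
  simp [h3, h4] at h2

theorem sum_coeff_ite {n : ℕ} (f : MvPolynomial (Fin n) K) (p : Fin n → ℕ) (A : K) :
    ∑ m ∈ f.support, coeff m f * (if (⇑m) = p then A else 0) = coeff (expOf p) f * A := by
  have : ∀ m : Fin n →₀ ℕ, (⇑m) = p ↔ m = expOf p := by
    intro m
    rw [← expOf_inj, expOf_coe]
  simp only [this, mul_ite, mul_zero]
  rw [Finset.sum_ite_eq' f.support (expOf p) (fun m => coeff m f * A)]
  split_ifs with h
  · rfl
  · rw [notMem_support_iff.mp h, zero_mul]

theorem orbT {n : ℕ} {μ p : Fin n → ℕ} {f : MvPolynomial (Fin n) K} (h : DS μ f) {i j : Fin n}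
    (hij : i ≠ j) (ho : Orb μ p) : coeff (expOf p) (TG tt i j f) =
      if p i < p j then coeff (expOf (p ∘ Equiv.swap i j)) f + (tt - 1) * coeff (expOf p) f
      else if p i = p j then tt * coeff (expOf p) f
      else tt * coeff (expOf (p ∘ Equiv.swap i j)) f := by
  have key : ∀ m ∈ f.support, coeff m f * coeff (expOf p) (TG tt i j (mm K (⇑m))) =
      coeff m f * (if (⇑m) = p then (if p i < p j then tt - 1 else if p i = p j then tt else 0) else 0)
      + coeff m f * (if (⇑m) = p ∘ Equiv.swap i j then
        (if p i < p j then 1 else if p i = p j then 0 else tt) else 0) := by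
    intro m hm
    have hd : Dom μ (⇑m) := h _ (by rw [expOf_coe]; exact mem_support_iff.mp hm)
    rw [coeff_TG_mm tt hij _ _ (not_inner hij ho hd), ← mul_add]
    congr 1
    have e : (⇑m) = p ∘ Equiv.swap i j ↔ (⇑m) ∘ Equiv.swap i j = p := by
      constructor
      · intro h; rw [h]; funext x; simp
      · intro h; rw [← h]; funext x; simp
    by_cases h1 : (⇑m) = p
    · rw [h1] at *
      rcases lt_trichotomy (p i) (p j) with h2 | h2 | h2
      · have h3 : p ≠ p ∘ Equiv.swap i j := by
          intro h4; have := congrFun h4 i; simp at this; omega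
        have h4 : p ∘ Equiv.swap i j ≠ p := h3.symm
        simp [h2, h2.not_gt, h2.ne, h3, h4]
      · simp [h2]
      · have h3 : p ≠ p ∘ Equiv.swap i j := by
          intro h4; have := congrFun h4 i; simp at this; omega
        have h4 : p ∘ Equiv.swap i j ≠ p := h3.symm
        simp [h2, h2.not_gt, h2.ne', h3, h4]
    · by_cases h2 : (⇑m) ∘ Equiv.swap i j = p
      · have h3 := e.mpr h2
        have hi : m i = p j := by rw [← h2]; simp
        have hj : m j = p i := by rw [← h2]; simp
        rw [hi, hj, if_neg h1, if_pos h3, if_pos h2, if_pos h2]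
        rcases lt_trichotomy (p i) (p j) with h4 | h4 | h4
        · simp [h4, h1]
        · simp [h4, h1]
        · simp [h4.not_gt, h4.ne, h4.ne', h1]
      · have h3 := e.not.mpr h2
        simp [h1, h2, h3]
  rw [coeff_TG tt hij, Finset.sum_congr rfl key, Finset.sum_add_distrib, sum_coeff_ite,
    sum_coeff_ite]
  split_ifs <;> ring

/-! the order -/

/-- prefix counting -/
def cnt {n : ℕ} (μ : Fin n → ℕ) (m c : ℕ) : ℕ :=
  (Finset.univ.filter (fun i : Fin n => i.val < m ∧ c ≤ μ i)).card

/-- prefix order -/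
def Pre {n : ℕ} (ν μ : Fin n → ℕ) : Prop := ∀ m c, cnt μ m c ≤ cnt ν m c

theorem cnt_succ {n : ℕ} (μ : Fin n → ℕ) (i : Fin n) (c : ℕ) :
    cnt μ (i.val + 1) c = cnt μ i.val c + if c ≤ μ i then 1 else 0 := by
  unfold cnt
  split_ifs with h
  · rw [← Finset.card_insert_of_notMem (a := i)]
    · congr 1
      ext k
      simp only [Finset.mem_filter, Finset.mem_univ, true_and, Finset.mem_insert]
      by_cases hk : k = i
      · subst hk; simp [h]
      · have : k.val ≠ i.val := fun h => hk (Fin.ext h)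
        simp only [hk, false_or]
        constructor
        · rintro ⟨h1, h2⟩; exact ⟨by omega, h2⟩
        · rintro ⟨h1, h2⟩; exact ⟨by omega, h2⟩
    · simp
  · rw [add_zero]
    congr 1
    ext k
    simp only [Finset.mem_filter, Finset.mem_univ, true_and]
    by_cases hk : k = i
    · subst hk; simp [h]
    · have : k.val ≠ i.val := fun h => hk (Fin.ext h)
      constructor
      · rintro ⟨h1, h2⟩; exact ⟨by omega, h2⟩
      · rintro ⟨h1, h2⟩; exact ⟨by omega, h2⟩

theorem cnt_swap {n : ℕ} (μ : Fin n → ℕ) {i j : Fin n} (hij : i.val + 1 = j.val) (m c : ℕ)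
    (hm : m ≠ j.val) : cnt (μ ∘ Equiv.swap i j) m c = cnt μ m c := by
  unfold cnt
  apply Finset.card_equiv (Equiv.swap i j)
  intro k
  simp only [Finset.mem_filter, Finset.mem_univ, true_and, Function.comp]
  have : k.val < m ↔ (Equiv.swap i j k).val < m := by
    rw [Equiv.swap_apply_def]
    split_ifs with h1 h2
    · subst h1; omega
    · subst h2; omega
    · rfl
  rw [this]

theorem pre_swap {n : ℕ} {μ ν : Fin n → ℕ} {i j : Fin n} (hij : i.val + 1 = j.val)
    (h : μ j < μ i) (hp : Pre ν μ) : Pre (ν ∘ Equiv.swap i j) (μ ∘ Equiv.swap i j) := by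
  intro m c
  by_cases hm : m = j.val
  · have a0 := hp i.val c
    have a1 := hp (i.val + 1) c
    have a2 := hp (j.val + 1) c
    have b1 := cnt_swap μ hij i.val c (by omega)
    have b2 := cnt_swap ν hij i.val c (by omega)
    rw [hm, ← hij]
    rw [cnt_succ, b1, cnt_succ, b2]
    rw [cnt_succ, cnt_succ, ← hij, cnt_succ, cnt_succ] at a2
    rw [cnt_succ, cnt_succ] at a1
    simp only [Function.comp, Equiv.swap_apply_left]
    split_ifs at * <;> omega
  · rw [cnt_swap μ hij m c hm, cnt_swap ν hij m c hm]
    exact hp m c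

theorem pre_right {n : ℕ} {μ ν : Fin n → ℕ} {i j : Fin n} (hij : i.val + 1 = j.val)
    (h : μ j < μ i) (hp : Pre ν μ) : Pre ν (μ ∘ Equiv.swap i j) := by
  intro m c
  by_cases hm : m = j.val
  · have a1 := hp (i.val + 1) c
    have b1 := cnt_swap μ hij i.val c (by omega)
    rw [hm, ← hij]
    refine le_trans ?_ a1
    rw [cnt_succ, b1, cnt_succ]
    simp only [Function.comp, Equiv.swap_apply_left]
    split_ifs at * <;> omega
  · rw [cnt_swap μ hij m c hm]
    exact hp m c

theorem not_pre {n : ℕ} {μ : Fin n → ℕ} {i j : Fin n} (hij : i.val + 1 = j.val)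
    (h : μ j < μ i) : ¬ Pre (μ ∘ Equiv.swap i j) μ := by
  intro hp
  have a1 := hp (i.val + 1) (μ i)
  have b1 := cnt_swap μ hij i.val (μ i) (by omega)
  rw [cnt_succ, cnt_succ, b1] at a1
  simp only [Function.comp, Equiv.swap_apply_left] at a1
  split_ifs at * <;> omega

theorem pre_part {n : ℕ} {l ν : Fin n → ℕ} (hl : IsPartition l) (ho : Orb l ν) (hp : Pre ν l) :
    ν = l := by
  have hge : ∀ i, l i ≤ ν i := by
    intro i
    have h := hp (i.val + 1) (l i)
    by_contra h1
    have hlt : cnt ν (i.val + 1) (l i) < cnt l (i.val + 1) (l i) := by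
      unfold cnt
      apply Finset.card_lt_card
      rw [Finset.ssubset_iff_of_subset]
      · exact ⟨i, by simp, by simp; omega⟩
      · intro k
        simp only [Finset.mem_filter, Finset.mem_univ, true_and]
        rintro ⟨h2, _⟩
        exact ⟨h2, hl k i (by rw [Fin.le_def]; omega)⟩
    omega
  have hs := ho.csize
  unfold csize at hs
  funext i
  exact ((Finset.sum_eq_sum_iff_of_le (fun i _ => hge i)).mp hs.symm i (Finset.mem_univ _)).symm

end IA

namespace IA
set_option linter.unusedSectionVars false

/-- `f` has all the properties of the interpolation polynomial, with value `g` at `q = 1` -/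
structure Good {n : ℕ} (μ : Fin n → ℕ) (f : MvPolynomial (Fin n) K)
    (g : MvPolynomial (Fin n) K1) : Prop where
  ds : DS μ f
  van : ∀ ν, csize ν ≤ csize μ → ν ≠ μ → eval (evalPt ν) f = 0
  one : coeff (expOf μ) f = 1
  tri : ∀ ν, Orb μ ν → coeff (expOf ν) f ≠ 0 → Pre ν μ
  rg : Rg f g

/-- intertwiner coefficient -/
def cK (a b : ℕ) : K := (tt - 1) * (qq ^ a * tt ^ b - 1)⁻¹
/-- intertwiner coefficient at `q = 1` -/
def c1 (b : ℕ) : K1 := (t1 - 1) * (t1 ^ b - 1)⁻¹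

theorem rg_cK (a b : ℕ) (hb : 0 < b) : RgC (cK a b) (c1 b) := by
  unfold cK c1
  apply RgC.mul (RgC.tt.sub RgC.one)
  apply RgC.inv _ (t1_pow_ne b hb)
  have := ((RgC.qq.pow a).mul (RgC.tt.pow b)).sub RgC.one
  rwa [one_pow, one_mul] at this

theorem c1_one : c1 1 = 1 := by
  unfold c1
  rw [pow_one, mul_inv_cancel₀]
  have := t1_pow_ne 1 one_pos
  rwa [pow_one] at this

theorem evalPt_ratio {n : ℕ} (μ : Fin n → ℕ) {i j : Fin n} (h : μ j < μ i) :
    evalPt μ i = evalPt μ j * (qq ^ (μ i - μ j) * tt ^ (kstat μ j - kstat μ i)) := by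
  have hk := kstat_lt μ (i := j) (j := i) (Or.inl h)
  unfold evalPt
  obtain ⟨a, ha⟩ : ∃ a, μ i = μ j + a := ⟨μ i - μ j, by omega⟩
  obtain ⟨b, hb⟩ : ∃ b, kstat μ j = kstat μ i + b := ⟨kstat μ j - kstat μ i, by omega⟩
  rw [ha, hb, Nat.add_sub_cancel_left, Nat.add_sub_cancel_left]
  push_cast
  rw [neg_add, zpow_add₀ tt_ne, zpow_neg tt (b : ℤ), zpow_natCast, pow_add]
  have := pow_ne_zero b tt_ne
  field_simp

theorem comp_swap_swap {n : ℕ} (ν : Fin n → ℕ) (i j : Fin n) :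
    (ν ∘ Equiv.swap i j) ∘ Equiv.swap i j = ν := by funext x; simp

theorem Good.step {n : ℕ} {μ : Fin n → ℕ} {f : MvPolynomial (Fin n) K}
    {g : MvPolynomial (Fin n) K1} (H : Good μ f g) {i j : Fin n} (hij : i.val + 1 = j.val)
    (h : μ j < μ i) :
    Good (μ ∘ Equiv.swap i j)
      (TG tt i j f + C (cK (μ i - μ j) (kstat μ j - kstat μ i)) * f)
      (TG t1 i j g + C (c1 (kstat μ j - kstat μ i)) * g) := by
  have hne : i ≠ j := by intro h; subst h; omega
  have hk := kstat_lt μ (i := j) (j := i) (Or.inl h)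
  have ho : Orb μ (μ ∘ Equiv.swap i j) := ⟨_, rfl⟩
  have hμ : μ ∘ Equiv.swap i j ≠ μ := by
    intro h4; have := congrFun h4 i; simp at this; omega
  refine ⟨?_, ?_, ?_, ?_, ?_⟩
  · exact ((H.ds.T hne).add (H.ds.Cmul _)).left ho
  · intro ν hν hν2
    rw [ho.csize] at hν
    rw [map_add, map_mul, eval_C]
    by_cases h1 : ν = μ
    · subst h1
      have h3 := TG_eval tt i j f (evalPt ν)
      have h4 : eval (evalPt (ν ∘ Equiv.swap i j)) f = 0 := H.van _ (by rw [ho.csize]) hμ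
      rw [evalPt_swap ν hij (by omega), h4, mul_zero, add_zero] at h3
      have h5 := evalPt_ratio ν h
      have h6 : evalPt ν i - evalPt ν j ≠ 0 := sub_ne_zero.mpr (evalPt_ne ν h)
      apply mul_left_cancel₀ h6
      rw [mul_add, h3, mul_zero]
      unfold cK
      rw [h5] at h6 ⊢
      set u := qq ^ (ν i - ν j) * tt ^ (kstat ν j - kstat ν i)
      have h7 : u - 1 ≠ 0 := by
        intro h8; apply h6; linear_combination evalPt ν j * h8
      have h8 : (u - 1) * (u - 1)⁻¹ = 1 := mul_inv_cancel₀ h7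
      linear_combination evalPt ν j * (tt - 1) * eval (evalPt ν) f * h8
    · rw [H.van ν hν h1, mul_zero, add_zero]
      apply eval_T_zero ν hij _ (H.van ν hν h1)
      intro _
      apply H.van
      · have : Orb ν (ν ∘ Equiv.swap i j) := ⟨_, rfl⟩
        rw [this.csize]; exact hν
      · intro h2
        apply hν2
        rw [← h2, comp_swap_swap]
  · have h1 : coeff (expOf (μ ∘ Equiv.swap i j)) f = 0 := by
      by_contra h2
      exact not_pre hij h (H.tri _ ho h2)
    rw [coeff_add, coeff_C_mul, orbT H.ds hne ho, comp_swap_swap, h1, H.one]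
    simp [h]
  · intro ν hν h1
    have hν : Orb μ ν := ho.trans hν
    by_cases h2 : coeff (expOf ν) f = 0
    · rw [coeff_add, coeff_C_mul, orbT H.ds hne hν, h2] at h1
      have h3 : coeff (expOf (ν ∘ Equiv.swap i j)) f ≠ 0 := by
        intro h3
        rw [h3] at h1
        simp at h1
      have := pre_swap hij h (H.tri _ (hν.perm _) h3)
      rwa [comp_swap_swap] at this
    · exact pre_right hij h (H.tri _ hν h2)
  · exact (H.rg.TG hne).add ((Rg.C (rg_cK _ _ (by omega))).mul H.rg)

theorem Good.zero {n : ℕ} : Good (fun _ : Fin n => 0) 1 1 := by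
  refine ⟨?_, ?_, ?_, ?_, Rg.one⟩
  · intro ν hν
    rw [coeff_one] at hν
    have h1 : (0 : Fin n →₀ ℕ) = expOf ν := by by_contra h; simp [h] at hν
    have h2 : ν = fun _ => 0 := by
      funext i; exact (DFunLike.congr_fun h1 i).symm
    rw [h2]; intro c; exact le_rfl
  · intro ν hν h
    exfalso; apply h
    funext i
    have h1 : csize (fun _ : Fin n => 0) = 0 := by simp [csize]
    rw [h1, Nat.le_zero] at hν
    unfold csize at hν
    exact Finset.sum_eq_zero_iff.mp hν i (Finset.mem_univ _)
  · rw [coeff_one, if_pos]; ext i; rfl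
  · rintro ν ⟨σ, rfl⟩ _ m c
    exact le_rfl

/-! coefficients of substitutions -/

theorem coeff_scale {n : ℕ} (σ : Equiv.Perm (Fin n)) (w : Fin n → K)
    (f : MvPolynomial (Fin n) K) (ρ : Fin n → ℕ) :
    coeff (expOf ρ) (aeval (fun k => C (w k) * X (σ k) : Fin n → MvPolynomial (Fin n) K) f) =
      (∏ k, w k ^ ρ (σ k)) * coeff (expOf (ρ ∘ σ)) f := by
  induction f using MvPolynomial.induction_on' with
  | add p q hp hq => rw [map_add, coeff_add, coeff_add, hp, hq, mul_add]
  | monomial m c =>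
    have h1 : aeval (fun k => C (w k) * X (σ k) : Fin n → MvPolynomial (Fin n) K) (monomial m c)
        = C (c * ∏ k, w k ^ m k) * mm K ((⇑m) ∘ σ.symm) := by
      rw [aeval_monomial, algebraMap_eq, Finsupp.prod_fintype _ _ (by simp), C_mul, mul_assoc]
      congr 1
      simp only [mul_pow]
      rw [Finset.prod_mul_distrib, mm_eq_prod, map_prod]
      congr 1
      · simp
      · apply Fintype.prod_equiv σ
        intro x; simp
    rw [h1, coeff_C_mul, coeff_mm, coeff_monomial]
    by_cases h2 : (⇑m) ∘ σ.symm = ρ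
    · have h3 : m = expOf (ρ ∘ σ) := by
        rw [← h2]; ext i; simp [expOf_apply]
      rw [if_pos h2, if_pos h3, ← h2]
      simp [mul_comm]
    · have h3 : ¬ m = expOf (ρ ∘ σ) := by
        intro h4; apply h2; rw [h4]; funext i; simp [expOf_apply]
      rw [if_neg h2, if_neg h3]; simp

/-- indicator -/
def ind {n : ℕ} (B : Finset (Fin n)) : Fin n → ℕ := fun i => if i ∈ B then 1 else 0

theorem prod_X {n : ℕ} (B : Finset (Fin n)) :
    ∏ i ∈ B, (X i : MvPolynomial (Fin n) K) = mm K (ind B) := by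
  rw [mm_eq_prod]
  unfold ind
  simp [Finset.prod_ite_mem]

theorem coeff_ind_mul {n : ℕ} (B : Finset (Fin n)) (G : MvPolynomial (Fin n) K) (ρ : Fin n → ℕ) :
    coeff (expOf ρ) (mm K (ind B) * G) =
      if ∀ i ∈ B, 0 < ρ i then coeff (expOf (fun i => ρ i - ind B i)) G else 0 := by
  unfold mm
  rw [coeff_monomial_mul', one_mul]
  have h : expOf (ind B) ≤ expOf ρ ↔ ∀ i ∈ B, 0 < ρ i := by
    rw [Finsupp.le_def]
    constructor
    · intro h i hi
      have := h i
      simp only [expOf_apply, ind, hi, if_true] at this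
      omega
    · intro h i
      simp only [expOf_apply, ind]
      split_ifs with h1
      · exact h i h1
      · omega
  have e : expOf ρ - expOf (ind B) = expOf (fun i => ρ i - ind B i) := by ext i; rfl
  rw [e]
  simp only [h]

theorem coeff_prod_mul {n : ℕ} (I : Finset (Fin n)) (a : K) (G : MvPolynomial (Fin n) K)
    (ρ : Fin n → ℕ) :
    coeff (expOf ρ) ((∏ i ∈ I, (X i - C a)) * G) =
      ∑ B ∈ I.powerset, (-a) ^ (I \ B).card *
        if ∀ i ∈ B, 0 < ρ i then coeff (expOf (fun i => ρ i - ind B i)) G else 0 := by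
  simp only [sub_eq_add_neg]
  rw [Finset.prod_add, Finset.sum_mul, coeff_sum]
  apply Finset.sum_congr rfl
  intro B _
  rw [Finset.prod_const, ← map_neg, ← C_pow, prod_X, mul_comm (mm K (ind B)), mul_assoc,
    coeff_C_mul, coeff_ind_mul]

theorem sum_ind_card {n : ℕ} (B : Finset (Fin n)) : ∑ i, ind B i = B.card := by
  unfold ind; simp

end IA

namespace IA
set_option linter.unusedSectionVars false

/-- first `l` positions -/
def Il (n l : ℕ) : Finset (Fin n) := Finset.univ.filter (fun i : Fin n => i.val < l)

theorem mem_Il {n l : ℕ} {i : Fin n} : i ∈ Il n l ↔ i.val < l := by unfold Il; simp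

theorem card_Il {n l : ℕ} (h : l ≤ n) : (Il n l).card = l := by
  unfold Il; rw [Fin.card_filter_val_lt]; omega

theorem up_zero {n l : ℕ} (h : l ≤ n) {μ' : Fin n → ℕ} (h0 : ∀ k : Fin n, k.val < n - l → μ' k = 0)
    {i : Fin n} (hi : ¬ i.val < l) : μ' (cyc l h i) = 0 := by
  apply h0
  rw [cyc_ge h hi]
  have := i.2
  omega

theorem up_eq {n l : ℕ} (h : l ≤ n) (μ' : Fin n → ℕ) (i : Fin n) :
    up l h μ' i = μ' (cyc l h i) + ind (Il n l) i := by
  unfold up ind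
  simp only [mem_Il]
  split_ifs <;> rfl

theorem dom_up {n l : ℕ} (h : l ≤ n) {μ' ρ' ρ : Fin n → ℕ}
    (h0 : ∀ k : Fin n, k.val < n - l → μ' k = 0) (B : Finset (Fin n)) (hB : B.card ≤ l)
    (hd : Dom μ' ρ') (hρ : ∀ i, ρ i = ρ' i + ind B i) : Dom (up l h μ') ρ := by
  intro c
  cases c with
  | zero =>
    have h1 := csize_up h μ'
    have h2 := hd.csize
    unfold csize at h1 h2
    simp only [Nat.sub_zero, hρ]
    rw [Finset.sum_add_distrib, sum_ind_card]
    omega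
  | succ c =>
    calc ∑ i, (ρ i - (c + 1)) ≤ ∑ i, (ρ' i - c) := by
          apply Finset.sum_le_sum
          intro i _
          rw [hρ i]
          unfold ind
          split_ifs <;> omega
      _ ≤ ∑ i, (μ' i - c) := hd c
      _ = ∑ i, (μ' (cyc l h i) - c) := (Equiv.sum_comp (cyc l h) (fun i => μ' i - c)).symm
      _ = ∑ i, (up l h μ' i - (c + 1)) := by
          apply Finset.sum_congr rfl
          intro i _
          unfold up
          split_ifs with hi
          · omega
          · rw [up_zero h h0 hi]; omega

theorem cnt_up {n l : ℕ} (h : l ≤ n) {μ' : Fin n → ℕ}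
    (h0 : ∀ k : Fin n, k.val < n - l → μ' k = 0) (m c : ℕ) :
    cnt (up l h μ') m (c + 2) = cnt μ' (m + (n - l)) (c + 1) := by
  unfold cnt
  apply Finset.card_equiv (cyc l h)
  intro i
  simp only [Finset.mem_filter, Finset.mem_univ, true_and]
  unfold up
  split_ifs with hi
  · rw [cyc_lt h hi]; omega
  · rw [up_zero h h0 hi]; omega

theorem cnt_up_one {n l : ℕ} (h : l ≤ n) {μ' : Fin n → ℕ}
    (h0 : ∀ k : Fin n, k.val < n - l → μ' k = 0) (m : ℕ) :
    cnt (up l h μ') m 1 = (Finset.univ.filter (fun i : Fin n => i.val < m ∧ i.val < l)).card := by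
  unfold cnt
  congr 1
  ext i
  simp only [Finset.mem_filter, Finset.mem_univ, true_and]
  unfold up
  split_ifs with hi
  · omega
  · rw [up_zero h h0 hi]; omega

theorem pre_up {n l : ℕ} (h : l ≤ n) {μ' ν' : Fin n → ℕ}
    (h0 : ∀ k : Fin n, k.val < n - l → μ' k = 0) (h0' : ∀ k : Fin n, k.val < n - l → ν' k = 0)
    (hp : Pre ν' μ') : Pre (up l h ν') (up l h μ') := by
  intro m c
  rcases c with _ | _ | c
  · unfold cnt; simp
  · rw [zero_add, cnt_up_one h h0, cnt_up_one h h0']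
  · rw [add_assoc, cnt_up h h0, cnt_up h h0']
    exact hp _ _

/-- an element of the orbit with positive first entries comes from the orbit below -/
theorem orb_up {n l : ℕ} (h : l ≤ n) {μ' ν' : Fin n → ℕ}
    (h0 : ∀ k : Fin n, k.val < n - l → μ' k = 0) (ho : Orb (up l h μ') (up l h ν')) :
    (∀ k : Fin n, k.val < n - l → ν' k = 0) ∧ Orb μ' ν' := by
  have h1 := ho.sum (fun x => if 0 < x then 1 else 0)
  have h2 : ∑ i, (if 0 < up l h μ' i then 1 else 0) = l := by
    refine Eq.trans ?_ (sum_ind h)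
    apply Finset.sum_congr rfl
    intro i _
    unfold up
    split_ifs with h3 h4 h5 <;> try rfl
    · omega
    · rw [up_zero h h0 h3] at h5; omega
  have h3 : ∀ i : Fin n, (if i.val < l then 1 else 0) ≤ (if 0 < up l h ν' i then 1 else 0) := by
    intro i
    unfold up
    split_ifs <;> omega
  have h1' := (sum_ind h).trans (h1.trans h2).symm
  have h4 := (Finset.sum_eq_sum_iff_of_le (fun i _ => h3 i)).mp h1'
  have h5 : ∀ k : Fin n, k.val < n - l → ν' k = 0 := by
    intro k hk
    have h6 := h4 ((cyc l h).symm k) (Finset.mem_univ _)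
    have h7 : ¬ ((cyc l h).symm k).val < l := by
      intro h8
      have h9 := cyc_lt h h8
      rw [Equiv.apply_symm_apply] at h9
      omega
    unfold up at h6
    simp only [h7, if_false, Equiv.apply_symm_apply] at h6
    split_ifs at h6
    omega
  refine ⟨h5, ?_⟩
  obtain ⟨σ, hσ⟩ := ho
  have key : ∀ (κ : Fin n → ℕ), (∀ k : Fin n, k.val < n - l → κ k = 0) →
      ∀ i, κ (cyc l h i) = up l h κ i - 1 := by
    intro κ hκ i
    unfold up
    split_ifs with hi
    · omega
    · rw [up_zero h hκ hi]
  refine ⟨(cyc l h).symm.trans (σ.trans (cyc l h)), ?_⟩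
  funext k
  have h6 := key ν' h5 ((cyc l h).symm k)
  rw [Equiv.apply_symm_apply] at h6
  rw [h6, hσ]
  simp only [Function.comp, Equiv.trans_apply]
  rw [key μ' h0]

/-- weights -/
def wt {n : ℕ} (l : ℕ) (h : l ≤ n) (k : Fin n) : K :=
  if ((cyc l h).symm k).val < l then qq⁻¹ else 1

/-- column operator -/
def colK {n : ℕ} (l : ℕ) (h : l ≤ n) (f : MvPolynomial (Fin n) K) : MvPolynomial (Fin n) K :=
  (∏ i ∈ Il n l, (X i - C (tt ^ (-((n - 1 : ℕ) : ℤ))))) *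
    aeval (fun k => C (wt l h k) * X ((cyc l h).symm k) : Fin n → MvPolynomial (Fin n) K) f

/-- column operator at `q = 1` -/
def col1 {n : ℕ} (l : ℕ) (h : l ≤ n) (g : MvPolynomial (Fin n) K1) : MvPolynomial (Fin n) K1 :=
  (∏ i ∈ Il n l, (X i - C ((t1 ^ (n - 1))⁻¹))) * rename (cyc l h).symm g

theorem rg_col {n l : ℕ} (h : l ≤ n) {f : MvPolynomial (Fin n) K} {g : MvPolynomial (Fin n) K1}
    (H : Rg f g) : Rg (colK l h f) (col1 l h g) := by
  unfold colK col1
  apply Rg.mul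
  · apply Rg.prod
    intro i _
    apply (Rg.X i).sub
    apply Rg.C
    rw [zpow_neg, zpow_natCast]
    exact (RgC.tt.pow _).inv (pow_ne_zero _ t1_ne)
  · have : rename (cyc l h).symm g = aeval (fun k => X ((cyc l h).symm k)) g := by
      have e : (rename (cyc l h).symm : MvPolynomial (Fin n) K1 →ₐ[K1] _) =
          aeval (fun k => X ((cyc l h).symm k)) := by
        apply MvPolynomial.algHom_ext
        intro i
        rw [rename_X, aeval_X]
      rw [e]
    rw [this]
    apply H.aeval
    intro k
    have h1 : Rg (C (wt l h k) : MvPolynomial (Fin n) K) (C 1) := by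
      apply Rg.C
      unfold wt
      split_ifs
      · have := RgC.qq.inv one_ne_zero
        rwa [inv_one] at this
      · exact RgC.one
    have := h1.mul (Rg.X ((cyc l h).symm k))
    rwa [C_1, one_mul] at this

theorem eval_col {n l : ℕ} (h : l ≤ n) (f : MvPolynomial (Fin n) K) (ν' : Fin n → ℕ)
    (hf : eval (evalPt ν') f = 0) : eval (evalPt (up l h ν')) (colK l h f) = 0 := by
  unfold colK
  rw [map_mul, eval_aeval]
  have : (fun k => eval (evalPt (up l h ν')) (C (wt l h k) * X ((cyc l h).symm k))) = evalPt ν' := by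
    funext k
    rw [map_mul, eval_C, eval_X, evalPt_up, Equiv.apply_symm_apply]
    unfold wt
    split_ifs
    · rw [← mul_assoc, inv_mul_cancel₀ qq_ne, one_mul]
    · rw [one_mul, one_mul]
  rw [this, hf, mul_zero]

theorem eval_col' {n l : ℕ} (h : l ≤ n) (f : MvPolynomial (Fin n) K) (ν : Fin n → ℕ)
    (hν : ¬ ∀ i : Fin n, i.val < l → 0 < ν i) : eval (evalPt ν) (colK l h f) = 0 := by
  obtain ⟨i, hi, h1⟩ := evalPt_zero h ν hν
  unfold colK
  rw [map_mul, map_prod, Finset.prod_eq_zero (mem_Il.mpr hi), zero_mul]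
  rw [map_sub, eval_X, eval_C, h1, sub_self]

theorem col_term {n l : ℕ} (h : l ≤ n) (f : MvPolynomial (Fin n) K) (ρ' : Fin n → ℕ)
    (hn : coeff (expOf ρ') (aeval (fun k => C (wt l h k) * X ((cyc l h).symm k) :
      Fin n → MvPolynomial (Fin n) K) f) ≠ 0) {μ' : Fin n → ℕ} (hd : DS μ' f) : Dom μ' ρ' := by
  rw [coeff_scale (cyc l h).symm] at hn
  have := hd _ (right_ne_zero_of_mul hn)
  exact this.right ⟨cyc l h, by funext i; simp⟩

theorem DS.col {n l : ℕ} (h : l ≤ n) {f : MvPolynomial (Fin n) K} {μ' : Fin n → ℕ}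
    (h0 : ∀ k : Fin n, k.val < n - l → μ' k = 0) (hd : DS μ' f) :
    DS (up l h μ') (colK l h f) := by
  intro ρ hρ
  unfold colK at hρ
  rw [coeff_prod_mul] at hρ
  obtain ⟨B, hB, h1⟩ := Finset.exists_ne_zero_of_sum_ne_zero hρ
  have h2 := right_ne_zero_of_mul h1
  split_ifs at h2 with h3
  · have h4 := col_term h f _ h2 hd
    refine dom_up h h0 B ?_ h4 ?_
    · rw [← card_Il h]
      exact Finset.card_le_card (Finset.mem_powerset.mp hB)
    · intro i
      unfold ind
      split_ifs with h5
      · have := h3 i h5; omega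
      · omega
  · exact absurd rfl h2

theorem coeff_col {n l : ℕ} (h : l ≤ n) {f : MvPolynomial (Fin n) K} {μ' : Fin n → ℕ}
    (hd : DS μ' f) (ρ : Fin n → ℕ) (ho : csize ρ = csize μ' + l) :
    coeff (expOf ρ) (colK l h f) = if ∀ i ∈ Il n l, 0 < ρ i then
      coeff (expOf (fun i => ρ i - ind (Il n l) i))
        (aeval (fun k => C (wt l h k) * X ((cyc l h).symm k) :
          Fin n → MvPolynomial (Fin n) K) f) else 0 := by
  unfold colK
  rw [coeff_prod_mul, Finset.sum_eq_single (Il n l)]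
  · simp
  · intro B hB hne
    by_contra h1
    have h2 := right_ne_zero_of_mul h1
    split_ifs at h2 with h3
    · have h4 := (col_term h f _ h2 hd).csize
      have h5 : ∑ i, ρ i = ∑ i, (ρ i - ind B i) + ∑ i, ind B i := by
        rw [← Finset.sum_add_distrib]
        apply Finset.sum_congr rfl
        intro i _
        unfold ind
        split_ifs with h5
        · have := h3 i h5; omega
        · omega
      rw [sum_ind_card] at h5
      have h6 : B.card < (Il n l).card := Finset.card_lt_card
        ((Finset.mem_powerset.mp hB).ssubset_of_ne hne)
      rw [card_Il h] at h6
      unfold csize at *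
      simp only at h4
      omega
    · exact h2 rfl
  · intro h1; simp at h1

theorem coeff_col_up {n l : ℕ} (h : l ≤ n) {f : MvPolynomial (Fin n) K} {μ' : Fin n → ℕ}
    (hd : DS μ' f) (ν' : Fin n → ℕ) (ho : csize ν' = csize μ')
    (h0 : ∀ k : Fin n, k.val < n - l → ν' k = 0) :

    coeff (expOf (up l h ν')) (C (qq ^ csize μ') * colK l h f) = coeff (expOf ν') f := by

  rw [coeff_C_mul, coeff_col h hd _ (by rw [csize_up, ho]), if_pos, coeff_scale (cyc l h).symm]
  · have h1 : (fun i => up l h ν' i - ind (Il n l) i) ∘ (cyc l h).symm = ν' := by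
      funext k
      simp [up_eq]
    rw [h1]
    have h2 : ∏ k, wt l h k ^ (up l h ν' ((cyc l h).symm k) - ind (Il n l) ((cyc l h).symm k)) =
        (qq ^ csize μ')⁻¹ := by
      rw [← ho]
      unfold csize
      rw [← Finset.prod_pow_eq_pow_sum, ← Finset.prod_inv_distrib]
      apply Finset.prod_congr rfl
      intro k _
      rw [up_eq, Equiv.apply_symm_apply, Nat.add_sub_cancel]
      unfold wt
      split_ifs with h3
      · rw [inv_pow]
      · rw [h0 k]
        · simp
        · have h4 := cyc_ge h h3
          rw [Equiv.apply_symm_apply] at h4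
          have := ((cyc l h).symm k).2
          omega
    rw [h2, ← mul_assoc, mul_inv_cancel₀ (pow_ne_zero _ qq_ne), one_mul]
  · intro i hi
    rw [mem_Il] at hi
    unfold up; simp [hi]

theorem Good.col {n l : ℕ} (h : l ≤ n) {μ' : Fin n → ℕ} {f : MvPolynomial (Fin n) K}
    {g : MvPolynomial (Fin n) K1} (H : Good μ' f g)
    (h0 : ∀ k : Fin n, k.val < n - l → μ' k = 0) :
    Good (up l h μ') (C (qq ^ csize μ') * colK l h f) (col1 l h g) := by
  refine ⟨(H.ds.col h h0).Cmul _, ?_, ?_, ?_, ?_⟩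
  · intro ν hν hne
    rw [map_mul]
    by_cases h1 : ∀ i : Fin n, i.val < l → 0 < ν i
    · obtain ⟨ν', rfl⟩ := exists_up h ν h1
      rw [eval_col h f ν', mul_zero]
      apply H.van
      · rw [csize_up, csize_up] at hν; omega
      · rintro rfl; exact hne rfl
    · rw [eval_col' h f ν h1, mul_zero]
  · rw [coeff_col_up h H.ds μ' rfl h0, H.one]
  · intro ρ ho hρ
    have hs := ho.csize
    rw [csize_up] at hs
    by_cases h1 : ∀ i : Fin n, i.val < l → 0 < ρ i
    · obtain ⟨ν', rfl⟩ := exists_up h ρ h1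
      obtain ⟨h2, h3⟩ := orb_up h h0 ho
      rw [coeff_col_up h H.ds ν' h3.csize h2] at hρ
      exact pre_up h h0 h2 (H.tri _ h3 hρ)
    · rw [coeff_C_mul, coeff_col h H.ds ρ hs, if_neg, mul_zero] at hρ
      · exact absurd rfl hρ
      · intro h2; apply h1; intro i hi; exact h2 i (mem_Il.mpr hi)
  · have := (Rg.C (n := n) (RgC.qq.pow (csize μ'))).mul (rg_col h H.rg)
    rwa [one_pow, C_1, one_mul] at this

end IA

namespace IA
set_option linter.unusedSectionVars false

/-- number of strict ascending pairs -/
def inv {n : ℕ} (μ : Fin n → ℕ) : ℕ :=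
  (Finset.univ.filter (fun p : Fin n × Fin n => p.1 < p.2 ∧ μ p.1 < μ p.2)).card

theorem swap_lt {n : ℕ} {i j : Fin n} (hij : i.val + 1 = j.val) {a b : Fin n}
    (h1 : ¬ (a = i ∧ b = j)) (h2 : ¬ (a = j ∧ b = i)) :
    a < b ↔ Equiv.swap i j a < Equiv.swap i j b := by
  rw [Equiv.swap_apply_def, Equiv.swap_apply_def]
  simp only [Fin.ext_iff] at h1 h2
  split_ifs with h3 h4 h5 h6 h7 h8 h9 <;> simp only [Fin.ext_iff, Fin.lt_def] at * <;> omega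

theorem inv_swap {n : ℕ} (μ : Fin n → ℕ) {i j : Fin n} (hij : i.val + 1 = j.val) (h : μ i < μ j) :
    inv μ = inv (μ ∘ Equiv.swap i j) + 1 := by
  have hlt : i < j := by rw [Fin.lt_def]; omega
  unfold inv
  set A := Finset.univ.filter (fun p : Fin n × Fin n => p.1 < p.2 ∧
    (μ ∘ Equiv.swap i j) p.1 < (μ ∘ Equiv.swap i j) p.2)
  let e : Fin n × Fin n ≃ Fin n × Fin n := Equiv.prodCongr (Equiv.swap i j) (Equiv.swap i j)
  have : Finset.univ.filter (fun p : Fin n × Fin n => p.1 < p.2 ∧ μ p.1 < μ p.2) =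
      insert (i, j) (A.map e.toEmbedding) := by
    ext ⟨a, b⟩
    simp only [Finset.mem_filter, Finset.mem_univ, true_and, Finset.mem_insert,
      Finset.mem_map_equiv, A, Prod.mk.injEq]
    have e1 : e.symm (a, b) = (Equiv.swap i j a, Equiv.swap i j b) := by
      simp [e]
    rw [e1]
    simp only [Function.comp, Equiv.swap_apply_self]
    by_cases h1 : a = i ∧ b = j
    · obtain ⟨rfl, rfl⟩ := h1
      simp [h, hlt]
    · by_cases h2 : a = j ∧ b = i
      · obtain ⟨rfl, rfl⟩ := h2
        simp only [h.not_gt, and_false, or_false]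
        simp only [false_iff]
        exact h1
      · rw [swap_lt hij h1 h2]
        simp [h1]
  rw [this, Finset.card_insert_of_notMem, Finset.card_map]
  simp only [Finset.mem_map_equiv, A, Finset.mem_filter, Finset.mem_univ, true_and]
  have e1 : e.symm (i, j) = (Equiv.swap i j i, Equiv.swap i j j) := by
    simp [e]
  rw [e1]
  simp [hlt.not_gt]

theorem part_of_adj {n : ℕ} (μ : Fin n → ℕ) (h : ∀ i j : Fin n, i.val + 1 = j.val → μ j ≤ μ i) :
    IsPartition μ := by
  have key : ∀ d : ℕ, ∀ i j : Fin n, j.val = i.val + d → μ j ≤ μ i := by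
    intro d
    induction d with
    | zero =>
      intro i j hj
      have : j = i := Fin.ext (by omega)
      rw [this]
    | succ d ih =>
      intro i j hj
      have hk : i.val + d < n := by have := j.2; omega
      exact (h ⟨i.val + d, hk⟩ j (by simp; omega)).trans (ih i ⟨i.val + d, hk⟩ rfl)
  intro i j hij
  rw [Fin.le_def] at hij
  exact key (j.val - i.val) i j (by omega)

theorem exists_asc {n : ℕ} (μ : Fin n → ℕ) (h : ¬ IsPartition μ) :
    ∃ i j : Fin n, i.val + 1 = j.val ∧ μ i < μ j := by
  by_contra h1
  push Not at h1
  exact h (part_of_adj μ h1)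

theorem inv_part {n : ℕ} {μ : Fin n → ℕ} (h : IsPartition μ) : inv μ = 0 := by
  unfold inv
  rw [Finset.card_eq_zero, Finset.filter_eq_empty_iff]
  rintro ⟨a, b⟩ _ ⟨h1, h2⟩
  have := h a b h1.le
  simp only at h2
  omega

theorem part_unique {n : ℕ} {l m : Fin n → ℕ} (hl : IsPartition l) (hm : IsPartition m)
    (h : Orb l m) : m = l := by
  obtain ⟨σ, rfl⟩ := h
  have := Tuple.unique_monotone (f := fun i => OrderDual.toDual (l i)) (σ := σ) (τ := 1)
    (by intro a b hab; exact hm a b hab) (by intro a b hab; exact hl a b hab)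
  funext i
  exact congrArg OrderDual.ofDual (congrFun this i)

/-- number of nonzero parts -/
def npos {n : ℕ} (μ : Fin n → ℕ) : ℕ := (Finset.univ.filter (fun i : Fin n => 0 < μ i)).card

theorem npos_le {n : ℕ} (μ : Fin n → ℕ) : npos μ ≤ n := by
  unfold npos
  refine (Finset.card_le_univ _).trans ?_
  simp

theorem pos_iff {n : ℕ} {μ : Fin n → ℕ} (h : IsPartition μ) (i : Fin n) :
    0 < μ i ↔ i.val < npos μ := by
  constructor
  · intro hi
    have h1 : (Il n (i.val + 1)).card ≤ npos μ := by
      apply Finset.card_le_card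
      intro k hk
      rw [mem_Il] at hk
      have := h k i (by rw [Fin.le_def]; omega)
      simp only [Finset.mem_filter, Finset.mem_univ, true_and]
      omega
    rw [card_Il (by have := i.2; omega)] at h1
    omega
  · intro hi
    by_contra h0
    have h1 : npos μ ≤ (Il n i.val).card := by
      apply Finset.card_le_card
      intro k hk
      simp only [Finset.mem_filter, Finset.mem_univ, true_and] at hk
      rw [mem_Il]
      by_contra h2
      have := h i k (by rw [Fin.le_def]; omega)
      omega
    rw [card_Il (by have := i.2; omega)] at h1
    omega

theorem exists_good {n : ℕ} : ∀ (d m : ℕ) (μ : Fin n → ℕ), csize μ = d → inv μ = m →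
    ∃ f g, Good μ f g := by
  intro d
  induction d using Nat.strong_induction_on with
  | _ d ihd =>
    intro m
    induction m using Nat.strong_induction_on with
    | _ m ihm =>
      intro μ hd hm
      by_cases hp : IsPartition μ
      · by_cases h0 : npos μ = 0
        · have : μ = fun _ => 0 := by
            funext i
            by_contra h1
            have := (pos_iff hp i).mp (by omega)
            omega
          rw [this]
          exact ⟨1, 1, Good.zero⟩
        · obtain ⟨μ', hμ'⟩ := exists_up (npos_le μ) μ (fun i hi => (pos_iff hp i).mpr hi)
          have hc := csize_up (npos_le μ) μ'
          rw [← hμ'] at hc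
          obtain ⟨f, g, H⟩ := ihd (csize μ') (by omega) _ μ' rfl rfl
          have := Good.col (npos_le μ) H (by
            intro k hk
            have h1 := congrFun hμ' ((cyc _ (npos_le μ)).symm k)
            have h2 : ¬ ((cyc _ (npos_le μ)).symm k).val < npos μ := by
              intro h8
              have h9 := cyc_lt (npos_le μ) h8
              rw [Equiv.apply_symm_apply] at h9
              omega
            unfold up at h1
            rw [if_neg h2, Equiv.apply_symm_apply] at h1
            have h3 := (pos_iff hp ((cyc _ (npos_le μ)).symm k)).not.mpr h2
            omega)
          rw [← hμ'] at this
          exact ⟨_, _, this⟩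
      · obtain ⟨i, j, hij, h⟩ := exists_asc μ hp
        have h1 := inv_swap μ hij h
        have ho : Orb μ (μ ∘ Equiv.swap i j) := ⟨_, rfl⟩
        obtain ⟨f, g, H⟩ := ihm (inv (μ ∘ Equiv.swap i j)) (by omega) (μ ∘ Equiv.swap i j)
          (by rw [ho.csize, hd]) rfl
        have := H.step hij (by simpa using h)
        rw [comp_swap_swap] at this
        exact ⟨_, _, this⟩

theorem good_ex {n : ℕ} (μ : Fin n → ℕ) : ∃ f g, Good μ f g := exists_good _ _ μ rfl rfl

theorem Good.isE {n : ℕ} {μ : Fin n → ℕ} {f : MvPolynomial (Fin n) K}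
    {g : MvPolynomial (Fin n) K1} (H : Good μ f g) : IsEstar μ f := ⟨H.ds.degree, H.one, H.van⟩

theorem estar_uniq {n : ℕ} {μ : Fin n → ℕ} {f f' : MvPolynomial (Fin n) K}
    (H : IsEstar μ f) (H' : IsEstar μ f') : f = f' := by
  have hne : eval (evalPt μ) f' ≠ 0 := by
    intro h0
    have : f' = 0 := by
      apply uniq n (csize μ) f' H'.1
      intro ν hν
      by_cases h : ν = μ
      · rw [h, h0]
      · exact H'.2.2 ν hν h
    have h1 := H'.2.1
    rw [this] at h1
    simp at h1
  set r := eval (evalPt μ) f / eval (evalPt μ) f' with hr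
  have h2 : f - C r * f' = 0 := by
    apply uniq n (csize μ)
    · refine (totalDegree_sub _ _).trans (max_le H.1 ?_)
      refine (totalDegree_mul _ _).trans ?_
      rw [totalDegree_C, zero_add]; exact H'.1
    · intro ν hν
      rw [map_sub, map_mul, eval_C]
      by_cases h : ν = μ
      · rw [h, hr]; field_simp; ring
      · rw [H.2.2 ν hν h, H'.2.2 ν hν h]; ring
  have h3 := congrArg (coeff (expOf μ)) h2
  rw [coeff_sub, coeff_C_mul, H.2.1, H'.2.1, coeff_zero, mul_one, sub_eq_zero] at h3
  rw [sub_eq_zero, ← h3, C_1, one_mul] at h2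
  exact h2

theorem Good.uniq {n : ℕ} {μ : Fin n → ℕ} {f f' : MvPolynomial (Fin n) K}
    {g g' : MvPolynomial (Fin n) K1} (H : Good μ f g) (H' : Good μ f' g') : f = f' ∧ g = g' := by
  have h := estar_uniq H.isE H'.isE
  subst h
  exact ⟨rfl, H.rg.unique H'.rg⟩

theorem Estar_eq {n : ℕ} {μ : Fin n → ℕ} {f : MvPolynomial (Fin n) K}
    {g : MvPolynomial (Fin n) K1} (H : Good μ f g) : Estar μ = f := by
  have h : ∃ f, IsEstar μ f := ⟨f, H.isE⟩
  unfold Estar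
  rw [dif_pos h]
  exact estar_uniq h.choose_spec H.isE

/-! ASEP polynomials -/

structure FS {n : ℕ} (l μ : Fin n → ℕ) (f : MvPolynomial (Fin n) K) : Prop where
  ds : DS l f
  van : ∀ ν, csize ν ≤ csize l → ¬ Orb l ν → eval (evalPt ν) f = 0
  co : ∀ ν, Orb l ν → coeff (expOf ν) f = if ν = μ then 1 else 0
  reg : ∃ g, Rg f g

theorem FS.base {n : ℕ} {l : Fin n → ℕ} (hl : IsPartition l) {f : MvPolynomial (Fin n) K}
    {g : MvPolynomial (Fin n) K1} (H : Good l f g) : FS l l f := by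
  refine ⟨H.ds, ?_, ?_, ⟨g, H.rg⟩⟩
  · intro ν hν ho
    apply H.van ν hν
    rintro rfl
    exact ho (Orb.refl _)
  · intro ν ho
    split_ifs with h
    · rw [h]; exact H.one
    · by_contra h1
      exact h (pre_part hl ho (H.tri ν ho h1))

theorem FS.step {n : ℕ} {l μ : Fin n → ℕ} {f : MvPolynomial (Fin n) K} (H : FS l μ f)
    {i j : Fin n} (hij : i.val + 1 = j.val) (h : μ j < μ i) :
    FS l (μ ∘ Equiv.swap i j) (TG tt i j f) := by
  have hne : i ≠ j := by intro h; subst h; omega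
  refine ⟨H.ds.T hne, ?_, ?_, ?_⟩
  · intro ν hν ho
    apply eval_T_zero ν hij _ (H.van ν hν ho)
    intro _
    apply H.van
    · have : Orb ν (ν ∘ Equiv.swap i j) := ⟨_, rfl⟩
      rw [this.csize]; exact hν
    · intro h1
      apply ho
      have := h1.perm (Equiv.swap i j)
      rwa [comp_swap_swap] at this
  · intro ν ho
    rw [orbT H.ds hne ho, H.co ν ho, H.co _ (ho.perm _)]
    have e : ν ∘ Equiv.swap i j = μ ↔ ν = μ ∘ Equiv.swap i j := by
      constructor
      · rintro rfl; rw [comp_swap_swap]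
      · rintro rfl; rw [comp_swap_swap]
    have e1 : ν = μ → ν j < ν i := by rintro rfl; exact h
    have e2 : ν = μ ∘ Equiv.swap i j → ν i < ν j := by rintro rfl; simpa using h
    simp only [e]
    by_cases h1 : ν = μ
    · have h3 := e1 h1
      have h2 : ν ≠ μ ∘ Equiv.swap i j := by intro h2; have := e2 h2; omega
      rw [if_neg h3.not_gt, if_neg h3.ne', if_neg h2, mul_zero]
    · rw [if_neg h1]
      by_cases h2 : ν = μ ∘ Equiv.swap i j
      · rw [if_pos h2, if_pos (e2 h2)]; ring
      · rw [if_neg h2]; split_ifs <;> ring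
  · obtain ⟨g, hg⟩ := H.reg
    exact ⟨_, hg.TG hne⟩

/-! words -/

theorem permAct_orb {n : ℕ} (σ : Equiv.Perm (Fin n)) (l : Fin n → ℕ) : Orb l (permAct σ l) :=
  ⟨σ.symm, rfl⟩

theorem mem_Sn {n : ℕ} {l μ : Fin n → ℕ} : μ ∈ Sn l ↔ Orb l μ := by
  constructor
  · rintro ⟨σ, rfl⟩; exact permAct_orb σ l
  · rintro ⟨σ, rfl⟩; exact ⟨σ.symm, rfl⟩

theorem mem_SnF {n : ℕ} {l μ : Fin n → ℕ} : μ ∈ SnFinset l ↔ Orb l μ := by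
  rw [← mem_Sn]
  unfold SnFinset Sn
  simp

theorem permAct_cons {n : ℕ} (i : {i : ℕ // i + 1 < n}) (w : List {i : ℕ // i + 1 < n})
    (l : Fin n → ℕ) : permAct (((i :: w).map adjSwap).prod) l =
      permAct ((w.map adjSwap).prod) l ∘
        Equiv.swap ⟨i.1, Nat.lt_of_succ_lt i.2⟩ ⟨i.1 + 1, i.2⟩ := by
  rw [List.map_cons, List.prod_cons]
  unfold permAct adjSwap
  funext k
  rfl

theorem word_lemma {n : ℕ} {l : Fin n → ℕ} (hl : IsPartition l) {E : MvPolynomial (Fin n) K}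
    (hE : FS l l E) (w : List {i : ℕ // i + 1 < n}) :
    inv (permAct ((w.map adjSwap).prod) l) ≤ w.length ∧
    (inv (permAct ((w.map adjSwap).prod) l) = w.length →
      FS l (permAct ((w.map adjSwap).prod) l) (Tword w E)) := by
  induction w with
  | nil =>
    have : permAct ((List.map adjSwap []).prod) l = l := rfl
    rw [this, inv_part hl]
    exact ⟨le_rfl, fun _ => hE⟩
  | cons i w ih =>
    rw [permAct_cons]
    set ν := permAct ((w.map adjSwap).prod) l
    set a : Fin n := ⟨i.1, Nat.lt_of_succ_lt i.2⟩
    set b : Fin n := ⟨i.1 + 1, i.2⟩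
    have hab : a.val + 1 = b.val := rfl
    rw [List.length_cons]
    rcases lt_trichotomy (ν a) (ν b) with h | h | h
    · have := inv_swap ν hab h
      constructor
      · omega
      · intro h2; omega
    · have : ν ∘ Equiv.swap a b = ν := by
        funext k
        simp only [Function.comp]
        rw [Equiv.swap_apply_def]
        split_ifs with h1 h2
        · rw [h1, h]
        · rw [h2, h]
        · rfl
      rw [this]
      constructor
      · omega
      · intro h2; omega
    · have := inv_swap (ν ∘ Equiv.swap a b) hab (by simpa using h)
      rw [comp_swap_swap] at this
      constructor
      · omega
      · intro h2
        exact (ih.2 (by omega)).step hab h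

theorem exists_word {n : ℕ} {l : Fin n → ℕ} (hl : IsPartition l) : ∀ (m : ℕ) (μ : Fin n → ℕ),
    inv μ = m → Orb l μ → ∃ w : List {i : ℕ // i + 1 < n},
      permAct ((w.map adjSwap).prod) l = μ ∧ w.length = m := by
  intro m
  induction m with
  | zero =>
    intro μ hm ho
    refine ⟨[], ?_, rfl⟩
    have : IsPartition μ := by
      by_contra hp
      obtain ⟨i, j, hij, h⟩ := exists_asc μ hp
      have := inv_swap μ hij h
      omega
    rw [part_unique hl this ho]
    rfl
  | succ m ih =>
    intro μ hm ho
    have : ¬ IsPartition μ := by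
      intro hp
      rw [inv_part hp] at hm; omega
    obtain ⟨i, j, hij, h⟩ := exists_asc μ this
    have h1 := inv_swap μ hij h
    obtain ⟨w, hw1, hw2⟩ := ih (μ ∘ Equiv.swap i j) (by omega) (ho.perm _)
    have hi : i.val + 1 < n := by rw [hij]; exact j.2
    refine ⟨⟨i.val, hi⟩ :: w, ?_, by rw [List.length_cons, hw2]⟩
    rw [permAct_cons, hw1]
    have : j = ⟨i.val + 1, hi⟩ := Fin.ext hij.symm
    subst this
    exact comp_swap_swap _ _ _

/-- strictly decreasing partition -/
def rhoP (n : ℕ) : Fin n → ℕ := fun k => n - 1 - k.val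

theorem rhoP_part (n : ℕ) : IsPartition (rhoP n) := by
  intro i j h
  unfold rhoP
  rw [Fin.le_def] at h
  omega

theorem rhoP_lt {n : ℕ} {a b : Fin n} : rhoP n a < rhoP n b ↔ b < a := by
  unfold rhoP
  rw [Fin.lt_def]
  have := a.2
  have := b.2
  omega

theorem rhoP_inj {n : ℕ} {a b : Fin n} (h : rhoP n a = rhoP n b) : a = b := by
  unfold rhoP at h
  apply Fin.ext
  have := a.2
  have := b.2
  omega

theorem permLength_eq {n : ℕ} (σ : Equiv.Perm (Fin n)) :
    permLength σ = inv (permAct σ (rhoP n)) := by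
  unfold permLength inv
  have h1 : {p : Fin n × Fin n | p.1 < p.2 ∧ σ p.2 < σ p.1} =
      ↑(Finset.univ.filter (fun p : Fin n × Fin n => p.1 < p.2 ∧ σ p.2 < σ p.1)) := by ext; simp
  rw [h1, Set.ncard_coe_finset]
  apply Finset.card_equiv ((Equiv.prodComm _ _).trans (Equiv.prodCongr σ σ))
  rintro ⟨a, b⟩
  simp only [Finset.mem_filter, Finset.mem_univ, true_and, permAct, Function.comp,
    Equiv.trans_apply, Equiv.prodComm_apply, Prod.swap, Equiv.prodCongr_apply, Prod.map,
    Equiv.symm_apply_apply, rhoP_lt]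
  tauto

theorem exists_reduced {n : ℕ} (σ : Equiv.Perm (Fin n)) : ∃ w, IsReducedWordOf w σ := by
  obtain ⟨w, h1, h2⟩ := exists_word (rhoP_part n) _ (permAct σ (rhoP n)) rfl (permAct_orb _ _)
  refine ⟨w, ?_, by rw [h2, permLength_eq]⟩
  have : ((w.map adjSwap).prod).symm = σ.symm := by
    ext k
    exact congrArg Fin.val (rhoP_inj (congrFun h1 k))
  rw [← Equiv.symm_symm (w.map adjSwap).prod, this, Equiv.symm_symm]

theorem permLength_le {n : ℕ} (w : List {i : ℕ // i + 1 < n}) :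
    permLength ((w.map adjSwap).prod) ≤ w.length := by
  rw [permLength_eq]
  obtain ⟨f, g, H⟩ := good_ex (rhoP n)
  exact (word_lemma (rhoP_part n) (FS.base (rhoP_part n) H) w).1

theorem fstar_FS {n : ℕ} {l μ : Fin n → ℕ} (hl : IsPartition l) (ho : Orb l μ) :
    FS l μ (fstar μ) := by
  have hs : sortDesc μ = l := by
    have h : ∃ l, IsPartition l ∧ μ ∈ Sn l := ⟨l, hl, mem_Sn.mpr ho⟩
    unfold sortDesc
    rw [dif_pos h]
    have h1 := h.choose_spec
    exact part_unique hl h1.1 (ho.trans (mem_Sn.mp h1.2).symm)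
  obtain ⟨f, g, H⟩ := good_ex l
  have hB := FS.base hl H
  unfold fstar
  rw [hs, Estar_eq H]
  have hsig : permAct (sigmaMin l μ) l = μ ∧
      ∀ τ, permAct τ l = μ → permLength (sigmaMin l μ) ≤ permLength τ := by
    have h : ∃ σ, permAct σ l = μ ∧ ∀ τ, permAct τ l = μ → permLength σ ≤ permLength τ := by
      have hne : (Finset.univ.filter (fun σ : Equiv.Perm (Fin n) => permAct σ l = μ)).Nonempty := by
        obtain ⟨σ, hσ⟩ := mem_Sn.mpr ho
        exact ⟨σ, by simpa using hσ⟩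
      obtain ⟨σ, h1, h2⟩ := Finset.exists_min_image _ permLength hne
      refine ⟨σ, by simpa using h1, ?_⟩
      intro τ hτ
      exact h2 τ (by simpa using hτ)
    unfold sigmaMin
    rw [dif_pos h]
    exact h.choose_spec
  obtain ⟨w, hw1, hw2⟩ := exists_word hl _ μ rfl ho
  have h1 := hsig.2 _ hw1
  have h2 := permLength_le w
  have h3 := exists_reduced (sigmaMin l μ)
  unfold Tsigma
  rw [dif_pos h3]
  obtain ⟨h4, h5⟩ := h3.choose_spec
  obtain ⟨h6, h7⟩ := word_lemma hl hB h3.choose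
  rw [h4, hsig.1] at h6 h7
  exact h7 (by omega)

theorem propX {n : ℕ} {l : Fin n → ℕ} (hl : IsPartition l) (h : MvPolynomial (Fin n) K)
    (hd : h.totalDegree ≤ csize l)
    (hv : ∀ ν, csize ν ≤ csize l → ¬ Orb l ν → eval (evalPt ν) h = 0) :
    h = ∑ ν ∈ SnFinset l, C (coeff (expOf ν) h) * fstar ν := by
  let O := {ν // ν ∈ SnFinset l}
  let lift : (O → K) →ₗ[K] MvPolynomial (Fin n) K :=
    { toFun := fun c => ∑ ν : O, c ν • fstar ν.1
      map_add' := by intro a b; simp [add_smul, Finset.sum_add_distrib]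
      map_smul' := by intro a b; simp [mul_smul, Finset.smul_sum] }
  let ev : MvPolynomial (Fin n) K →ₗ[K] (O → K) :=
    { toFun := fun f ν => eval (evalPt ν.1) f
      map_add' := by intro a b; funext ν; simp
      map_smul' := by intro a b; funext ν; simp [smul_eval] }
  have hF : ∀ ν : O, FS l ν.1 (fstar ν.1) := fun ν => fstar_FS hl (mem_SnF.mp ν.2)
  have hlift : ∀ c : O → K, lift c = ∑ ν : O, c ν • fstar ν.1 := fun c => rfl
  have hdeg : ∀ c, (lift c).totalDegree ≤ csize l := by
    intro c
    rw [hlift]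
    apply totalDegree_finsetSum_le
    intro ν _
    exact (totalDegree_smul_le _ _).trans (hF ν).ds.degree
  have hvan : ∀ c ν, csize ν ≤ csize l → ¬ Orb l ν → eval (evalPt ν) (lift c) = 0 := by
    intro c ν h1 h2
    rw [hlift, map_sum]
    apply Finset.sum_eq_zero
    intro ρ _
    rw [smul_eval, (hF ρ).van ν h1 h2, mul_zero]
  have hco : ∀ c (ν : O), coeff (expOf ν.1) (lift c) = c ν := by
    intro c ν
    rw [hlift, coeff_sum, Finset.sum_eq_single ν]
    · rw [coeff_smul, (hF ν).co _ (mem_SnF.mp ν.2), if_pos rfl]; simp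
    · intro ρ _ h1
      rw [coeff_smul, (hF ρ).co _ (mem_SnF.mp ν.2), if_neg]
      · simp
      · intro h2; exact h1 (Subtype.ext h2.symm)
    · intro h1; exact absurd (Finset.mem_univ _) h1
  have huniq : ∀ f f' : MvPolynomial (Fin n) K, f.totalDegree ≤ csize l →
      f'.totalDegree ≤ csize l →
      (∀ ν, csize ν ≤ csize l → ¬ Orb l ν → eval (evalPt ν) f = 0) →
      (∀ ν, csize ν ≤ csize l → ¬ Orb l ν → eval (evalPt ν) f' = 0) →
      ev f = ev f' → f = f' := by
    intro f f' h1 h2 h3 h4 h5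
    rw [← sub_eq_zero]
    apply uniq n (csize l)
    · exact (totalDegree_sub _ _).trans (max_le h1 h2)
    · intro ν hν
      rw [map_sub, sub_eq_zero]
      by_cases ho : Orb l ν
      · exact congrFun h5 ⟨ν, mem_SnF.mpr ho⟩
      · rw [h3 ν hν ho, h4 ν hν ho]
  have hinj : Function.Injective (ev ∘ₗ lift) := by
    intro c c' hc
    have := huniq _ _ (hdeg c) (hdeg c') (hvan c) (hvan c') hc
    funext ν
    rw [← hco c ν, this, hco]
  obtain ⟨c, hc⟩ := LinearMap.injective_iff_surjective.mp hinj (ev h)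
  have h1 : lift c = h := huniq _ _ (hdeg c) hd (hvan c) hv hc
  rw [← Finset.sum_coe_sort]
  conv_lhs => rw [← h1, hlift]
  apply Finset.sum_congr rfl
  intro ν _
  rw [← h1, hco, smul_eq_C_mul]

end IA

namespace IA
set_option linter.unusedSectionVars false

/-- specialization of `fstar` at `q = 1` -/
def gs {n : ℕ} (μ : Fin n → ℕ) : MvPolynomial (Fin n) K1 :=
  if h : ∃ g, Rg (fstar μ) g then h.choose else 0

theorem gs_rg {n : ℕ} {l μ : Fin n → ℕ} (hl : IsPartition l) (ho : Orb l μ) :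
    Rg (fstar μ) (gs μ) := by
  have h := (fstar_FS hl ho).reg
  unfold gs
  rw [dif_pos h]
  exact h.choose_spec

theorem FS.eq {n : ℕ} {l μ : Fin n → ℕ} (hl : IsPartition l) (ho : Orb l μ)
    {f : MvPolynomial (Fin n) K} (H : FS l μ f) : f = fstar μ := by
  rw [propX hl f H.ds.degree H.van, Finset.sum_eq_single μ]
  · rw [H.co μ ho, if_pos rfl, C_1, one_mul]
  · intro ν hν hne
    rw [H.co ν (mem_SnF.mp hν), if_neg hne, C_0, zero_mul]
  · intro h; exact absurd (mem_SnF.mpr ho) h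

theorem gs_step {n : ℕ} {l μ : Fin n → ℕ} (hl : IsPartition l) (ho : Orb l μ)
    {i j : Fin n} (hij : i.val + 1 = j.val) (h : μ j < μ i) :
    gs (μ ∘ Equiv.swap i j) = TG t1 i j (gs μ) := by
  have hne : i ≠ j := by intro h; subst h; omega
  have e := FS.eq hl (ho.perm _) ((fstar_FS hl ho).step hij h)
  have h1 := (gs_rg hl ho).TG hne
  rw [e] at h1
  exact (gs_rg hl (ho.perm _)).unique h1

theorem gs_expand {n : ℕ} {l α : Fin n → ℕ} (hl : IsPartition l) (ho : Orb l α)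
    {f : MvPolynomial (Fin n) K} {g : MvPolynomial (Fin n) K1} (H : Good α f g) :
    g = ∑ ν ∈ SnFinset l, C (coeff (expOf ν) g) * gs ν := by
  have h1 : f.totalDegree ≤ csize l := by
    rw [← ho.csize]; exact H.ds.degree
  have e := propX hl f h1 (by
    intro ν hν hn
    apply H.van ν (by rw [ho.csize]; exact hν)
    rintro rfl
    exact hn ho)
  have h2 : Rg (∑ ν ∈ SnFinset l, C (coeff (expOf ν) f) * fstar ν)
      (∑ ν ∈ SnFinset l, C (coeff (expOf ν) g) * gs ν) := by
    apply Rg.sum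
    intro ν hν
    exact (Rg.C (H.rg.coeff _)).mul (gs_rg hl (mem_SnF.mp hν))
  rw [← e] at h2
  exact H.rg.unique h2

theorem kstat_swap {n : ℕ} (ν : Fin n → ℕ) {i j : Fin n} (hij : i.val + 1 = j.val)
    (h : ν i ≠ ν j) (a : Fin n) :
    kstat ν (Equiv.swap i j a) = kstat (ν ∘ Equiv.swap i j) a := by
  revert a
  apply kstat_perm
  intro a b
  have hne : i ≠ j := by intro h; subst h; omega
  unfold Bt
  simp only [Function.comp]
  have key : ν (Equiv.swap i j a) = ν (Equiv.swap i j b) →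
      (Equiv.swap i j a < Equiv.swap i j b ↔ a < b) := by
    intro hab
    rw [Equiv.swap_apply_def, Equiv.swap_apply_def] at hab ⊢
    split_ifs at hab ⊢ with h1 h2 h3 h4 h5 h6 h7
    all_goals first
      | (exfalso; exact h hab)
      | (exfalso; exact h hab.symm)
      | (simp only [Fin.ext_iff, Fin.lt_def] at * <;> omega)
  constructor
  · rintro (h1 | ⟨h1, h2⟩)
    · exact Or.inl h1
    · exact Or.inr ⟨h1, (key h1).mp h2⟩
  · rintro (h1 | ⟨h1, h2⟩)
    · exact Or.inl h1
    · exact Or.inr ⟨h1, (key h1).mpr h2⟩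

theorem sym_adj {n : ℕ} {α : Fin n → ℕ} (hα : ∀ a b : Fin n, a ≤ b → α a ≤ α b)
    {f : MvPolynomial (Fin n) K} {g : MvPolynomial (Fin n) K1} (H : Good α f g)
    {i j : Fin n} (hij : i.val + 1 = j.val) : rename (Equiv.swap i j) g = g := by
  have hne : i ≠ j := by intro h; subst h; omega
  have hle : α i ≤ α j := hα i j (by rw [Fin.le_def]; omega)
  rcases hle.eq_or_lt with he | hlt
  · have hz : TG tt i j f + C (-tt) * f = 0 := by
      apply uniq n (csize α)
      · exact ((H.ds.T hne).add (H.ds.Cmul _)).degree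
      · intro ν hν
        rw [map_add, map_mul, eval_C]
        by_cases h1 : ν = α
        · subst h1
          rw [eval_T_eq ν hij he]; ring
        · have h2 := H.van ν hν h1
          rw [h2, mul_zero, add_zero]
          apply eval_T_zero ν hij f h2
          intro h3
          apply H.van
          · have : Orb ν (ν ∘ Equiv.swap i j) := ⟨_, rfl⟩
            rw [this.csize]; exact hν
          · intro h4
            apply h3
            have h5 : (ν ∘ Equiv.swap i j) i = α i := by rw [h4]
            have h6 : (ν ∘ Equiv.swap i j) j = α j := by rw [h4]
            simp at h5 h6
            omega
    have h1 : TG tt i j f = C tt * f := by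
      have : TG tt i j f = (TG tt i j f + C (-tt) * f) + C tt * f := by
        rw [C_neg]; ring
      rw [this, hz, zero_add]
    have h2 := H.rg.TG hne
    rw [h1] at h2
    apply sym_of_TG t1 hne t1_ne
    exact h2.unique ((Rg.C RgC.tt).mul H.rg)
  · obtain ⟨f', g', H'⟩ := good_ex (α ∘ Equiv.swap i j)
    have h2 := H'.step hij (by simpa using hlt)
    have e1 := kstat_swap α hij hlt.ne i
    have e2 := kstat_swap α hij hlt.ne j
    rw [Equiv.swap_apply_left] at e1
    rw [Equiv.swap_apply_right] at e2
    have e3 := kstat_mono α hα hij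
    have e4 : kstat (α ∘ Equiv.swap i j) j - kstat (α ∘ Equiv.swap i j) i = 1 := by
      rw [← e1, ← e2]; omega
    rw [comp_swap_swap, e4, c1_one, C_1, one_mul] at h2
    rw [(H.uniq h2).2]
    exact TG_add_one_sym t1 hne g'

theorem sym_all {n : ℕ} {g : MvPolynomial (Fin n) K1}
    (h : ∀ i j : Fin n, i.val + 1 = j.val → rename (Equiv.swap i j) g = g)
    (σ : Equiv.Perm (Fin n)) : rename σ g = g := by
  rcases n with _ | n
  · have : σ = 1 := Subsingleton.elim _ _
    subst this
    exact rename_id_apply g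
  have hm : σ ∈ Submonoid.closure
      (Set.range fun i : Fin n ↦ Equiv.swap i.castSucc i.succ) := by
    rw [Equiv.Perm.mclosure_swap_castSucc_succ]; trivial
  induction hm using Submonoid.closure_induction with
  | mem x hx =>
    obtain ⟨i, rfl⟩ := hx
    exact h _ _ (by simp)
  | one => exact rename_id_apply g
  | mul x y _ _ hx hy =>
    rw [Equiv.Perm.coe_mul, ← rename_rename, hy, hx]

/-- sum over the orbit -/
def HS {n : ℕ} (κ : Fin n → ℕ) : MvPolynomial (Fin n) K1 := ∑ ν ∈ SnFinset κ, gs ν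

theorem HS_good {n : ℕ} {κ : Fin n → ℕ} (hκ : IsPartition κ) :
    ∃ f, Good (κ ∘ Fin.revPerm) f (HS κ) ∧ (∀ σ : Equiv.Perm (Fin n), rename σ (HS κ) = HS κ) ∧
      ∀ ν, Orb κ ν → coeff (expOf ν) (HS κ) = 1 := by
  obtain ⟨f, g, H⟩ := good_ex (κ ∘ Fin.revPerm)
  have ho : Orb κ (κ ∘ Fin.revPerm) := ⟨_, rfl⟩
  have hs : ∀ σ : Equiv.Perm (Fin n), rename σ g = g := by
    apply sym_all
    intro i j hij
    apply sym_adj _ H hij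
    intro a b hab
    exact hκ _ _ (by simpa using hab)
  have h1 : coeff (expOf (κ ∘ Fin.revPerm)) g = 1 := by
    have := H.rg.coeff (expOf (κ ∘ Fin.revPerm))
    rw [H.one] at this
    exact this.unique RgC.one
  have h2 : ∀ ν, Orb κ ν → coeff (expOf ν) g = 1 := by
    intro ν hν
    obtain ⟨σ, rfl⟩ := ho.symm.trans hν
    rw [← coeff_rename_perm, hs, h1]
  have e : g = HS κ := by
    rw [gs_expand hκ ho H]
    apply Finset.sum_congr rfl
    intro ν hν
    rw [h2 ν (mem_SnF.mp hν), C_1, one_mul]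
  rw [e] at H hs h2
  exact ⟨f, H, hs, h2⟩

end IA

namespace IA
set_option linter.unusedSectionVars false

/-- support -/
def suppF {n : ℕ} (μ : Fin n → ℕ) : Finset (Fin n) := Finset.univ.filter (fun i : Fin n => 0 < μ i)

theorem mem_suppF {n : ℕ} {μ : Fin n → ℕ} {i : Fin n} : i ∈ suppF μ ↔ 0 < μ i := by
  simp [suppF]

theorem card_suppF {n : ℕ} {l μ : Fin n → ℕ} (h : Orb l μ) : (suppF μ).card = npos l := by
  unfold npos suppF
  rw [Finset.card_filter, Finset.card_filter]
  exact h.sum (fun x => if 0 < x then 1 else 0)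

/-- remove the first column -/
def dn {n : ℕ} (l : Fin n → ℕ) : Fin n → ℕ := fun i => l i - 1

theorem dn_part {n : ℕ} {l : Fin n → ℕ} (hl : IsPartition l) : IsPartition (dn l) := by
  intro i j hij
  have := hl i j hij
  unfold dn; omega

/-- partial sum over given support -/
def FSum {n : ℕ} (l : Fin n → ℕ) (S : Finset (Fin n)) : MvPolynomial (Fin n) K1 :=
  ∑ μ ∈ (SnFinset l).filter (fun μ => suppF μ = S), gs μ

/-- number of missing elements to the left -/
def Dc {n : ℕ} (S : Finset (Fin n)) (i : Fin n) : ℕ :=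
  (Finset.univ.filter (fun j : Fin n => j < i ∧ j ∉ S)).card

/-- product factor -/
def PS {n : ℕ} (S : Finset (Fin n)) : MvPolynomial (Fin n) K1 :=
  ∏ i ∈ S, (X i - C (t1 ^ Dc S i / t1 ^ (n - 1)))

theorem up_dn {n : ℕ} {l : Fin n → ℕ} (hl : IsPartition l) :
    up (npos l) (npos_le l) (dn l ∘ Fin.revPerm) =
      l ∘ ((cyc (npos l) (npos_le l)).trans Fin.revPerm) := by
  funext i
  have hL := npos_le l
  unfold up
  simp only [Function.comp, Equiv.trans_apply, Fin.revPerm_apply, dn]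
  have hp := pos_iff hl (Fin.rev (cyc (npos l) (npos_le l) i))
  rw [Fin.val_rev] at hp
  have hi := i.isLt
  split_ifs with h
  · rw [cyc_lt _ h] at hp
    have := hp.mpr (by omega)
    omega
  · rw [cyc_ge _ h] at hp
    have : ¬ (0 < l (Fin.rev (cyc (npos l) (npos_le l) i))) := by
      rw [hp]; omega
    omega

theorem FSum_Il {n : ℕ} {l : Fin n → ℕ} (hl : IsPartition l) :
    FSum l (Il n (npos l)) = PS (Il n (npos l)) * HS (dn l) := by
  obtain ⟨f, H, hs, hc⟩ := HS_good (dn_part hl)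
  have hL := npos_le l
  have h0 : ∀ k : Fin n, k.val < n - npos l → (dn l ∘ Fin.revPerm) k = 0 := by
    intro k hk
    simp only [Function.comp, Fin.revPerm_apply, dn]
    have hp := pos_iff hl (Fin.rev k)
    rw [Fin.val_rev] at hp
    have : ¬ (0 < l (Fin.rev k)) := by rw [hp]; omega
    omega
  have G := H.col hL h0
  have hα : Orb l (up (npos l) hL (dn l ∘ Fin.revPerm)) := ⟨_, up_dn hl⟩
  have e := gs_expand hl hα G
  have hP : col1 (npos l) hL (HS (dn l)) = PS (Il n (npos l)) * HS (dn l) := by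
    unfold col1 PS
    rw [hs]
    congr 1
    apply Finset.prod_congr rfl
    intro i hi
    rw [mem_Il] at hi
    have : Dc (Il n (npos l)) i = 0 := by
      unfold Dc
      rw [Finset.card_eq_zero, Finset.filter_eq_empty_iff]
      rintro j - ⟨h1, h2⟩
      rw [mem_Il] at h2
      rw [Fin.lt_def] at h1
      omega
    rw [this, pow_zero, one_div]
  rw [← hP, e]
  unfold FSum
  rw [Finset.sum_filter]
  apply Finset.sum_congr rfl
  intro ν hν
  have ho : Orb l ν := mem_SnF.mp hν
  have hr := G.rg.coeff (expOf ν)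
  by_cases hS : suppF ν = Il n (npos l)
  · rw [if_pos hS]
    obtain ⟨ν', rfl⟩ := exists_up hL ν (by
      intro i hi
      rw [← mem_suppF, hS, mem_Il]; exact hi)
    obtain ⟨h1, h2⟩ := orb_up hL h0 (hα.symm.trans ho)
    rw [coeff_col_up hL H.ds ν' h2.csize h1] at hr
    have h3 : Orb (dn l) ν' := by
      have : Orb (dn l) (dn l ∘ Fin.revPerm) := ⟨_, rfl⟩
      exact this.trans h2
    rw [hr.unique (H.rg.coeff _), hc ν' h3, C_1, one_mul]
  · rw [if_neg hS]
    have h1 : ¬ ∀ i ∈ Il n (npos l), 0 < ν i := by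
      intro h
      apply hS
      symm
      apply Finset.eq_of_subset_of_card_le
      · intro i hi; rw [mem_suppF]; exact h i hi
      · rw [card_suppF ho, card_Il hL]
    have h2 : csize ν = csize (dn l ∘ Fin.revPerm) + npos l := by
      rw [← csize_up hL, ho.csize, hα.csize]
    rw [coeff_C_mul, coeff_col hL H.ds ν h2, if_neg h1, mul_zero] at hr
    have h3 : RgC 0 0 := ⟨0, map_zero _, map_zero _⟩
    rw [hr.unique h3, C_0, zero_mul]

theorem TG_lin {n : ℕ} {i j : Fin n} (hne : i ≠ j) (a : K1) :
    TG t1 i j (X i - C a : MvPolynomial (Fin n) K1) = X j - C (t1 * a) := by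
  apply TG_unique t1 hne
  rw [C_sub, C_1, C_mul, map_sub, rename_X, rename_C, Equiv.swap_apply_left]
  ring

theorem FSum_step {n : ℕ} {l : Fin n → ℕ} (hl : IsPartition l) {S S' : Finset (Fin n)}
    {i j : Fin n} (hij : i.val + 1 = j.val) (hi : i ∉ S) (hj : j ∈ S)
    (hS' : ∀ x, x ∈ S' ↔ Equiv.swap i j x ∈ S) :
    FSum l S = TG t1 i j (FSum l S') := by
  have hne : i ≠ j := by intro h; subst h; omega
  have key : ∀ μ : Fin n → ℕ, suppF μ = S → suppF (μ ∘ Equiv.swap i j) = S' := by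
    intro μ h; ext x
    rw [mem_suppF, hS', ← h, mem_suppF]; rfl
  have key2 : ∀ μ : Fin n → ℕ, suppF μ = S' → suppF (μ ∘ Equiv.swap i j) = S := by
    intro μ h; ext x
    rw [mem_suppF]
    change 0 < μ (Equiv.swap i j x) ↔ _
    rw [← mem_suppF, h, hS', Equiv.swap_apply_self]
  unfold FSum
  rw [← TL_apply t1 hne, map_sum]
  refine Finset.sum_nbij' (fun μ => μ ∘ Equiv.swap i j) (fun μ => μ ∘ Equiv.swap i j) ?_ ?_ ?_ ?_ ?_
  · intro μ hμ
    rw [Finset.mem_filter, mem_SnF] at hμ ⊢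
    exact ⟨hμ.1.perm _, key μ hμ.2⟩
  · intro μ hμ
    rw [Finset.mem_filter, mem_SnF] at hμ ⊢
    exact ⟨hμ.1.perm _, key2 μ hμ.2⟩
  · intro μ _; exact comp_swap_swap μ i j
  · intro μ _; exact comp_swap_swap μ i j
  · intro μ hμ
    rw [Finset.mem_filter, mem_SnF] at hμ
    rw [TL_apply, ← gs_step hl (hμ.1.perm _) hij, comp_swap_swap]
    have h1 : 0 < μ j := by rw [← mem_suppF, hμ.2]; exact hj
    have h2 : ¬ 0 < μ i := by rw [← mem_suppF, hμ.2]; exact hi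
    simp only [Function.comp, Equiv.swap_apply_left, Equiv.swap_apply_right]
    omega

theorem PS_step {n : ℕ} {S S' : Finset (Fin n)}
    {i j : Fin n} (hij : i.val + 1 = j.val) (hi : i ∉ S) (hj : j ∈ S)
    (hS' : ∀ x, x ∈ S' ↔ Equiv.swap i j x ∈ S) :
    PS S = TG t1 i j (PS S') := by
  have hne : i ≠ j := by intro h; subst h; omega
  have hi' : i ∈ S' := by rw [hS', Equiv.swap_apply_left]; exact hj
  have hj' : j ∉ S' := by rw [hS', Equiv.swap_apply_right]; exact hi
  have hx : ∀ x, x ≠ i → x ≠ j → (x ∈ S' ↔ x ∈ S) := by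
    intro x h1 h2
    rw [hS', Equiv.swap_apply_of_ne_of_ne h1 h2]
  have hE : S'.erase i = S.erase j := by
    ext x
    rw [Finset.mem_erase, Finset.mem_erase]
    by_cases h1 : x = i
    · subst h1; simp [hi]
    by_cases h2 : x = j
    · subst h2; simp [hj']
    simp [h1, h2, hx x h1 h2]
  have hD1 : Dc S j = Dc S' i + 1 := by
    unfold Dc
    have : Finset.univ.filter (fun x : Fin n => x < j ∧ x ∉ S) =
        insert i (Finset.univ.filter (fun x : Fin n => x < i ∧ x ∉ S')) := by
      ext x
      simp only [Finset.mem_filter, Finset.mem_univ, true_and, Finset.mem_insert]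
      by_cases h1 : x = i
      · subst h1; simp only [true_or, iff_true]
        exact ⟨by rw [Fin.lt_def]; omega, hi⟩
      by_cases h2 : x = j
      · subst h2
        simp only [lt_irrefl, false_and, h1, false_or, false_iff]
        rintro ⟨h3, -⟩
        rw [Fin.lt_def] at h3; omega
      rw [hx x h1 h2]
      have : x < j ↔ x < i := by
        simp only [Fin.lt_def, Fin.ext_iff] at *; omega
      simp [h1, this]
    rw [this, Finset.card_insert_of_notMem (by simp)]
  have hD2 : ∀ k ∈ S.erase j, Dc S k = Dc S' k := by
    intro k hk
    rw [Finset.mem_erase] at hk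
    have hki : k ≠ i := by rintro rfl; exact hi hk.2
    unfold Dc
    refine Finset.card_nbij' (Equiv.swap i j) (Equiv.swap i j) ?_ ?_ ?_ ?_
    · intro x hx
      simp only [Finset.coe_filter, Finset.mem_univ, true_and, Set.mem_ofPred_eq] at hx ⊢
      rw [hS', Equiv.swap_apply_self]
      refine ⟨?_, hx.2⟩
      have h1 := hx.1
      have h2 := hk.1
      rw [Equiv.swap_apply_def]
      split_ifs <;> simp only [Fin.lt_def, Fin.ext_iff, ne_eq] at * <;> omega
    · intro x hx
      simp only [Finset.coe_filter, Finset.mem_univ, true_and, Set.mem_ofPred_eq] at hx ⊢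
      rw [hS'] at hx
      refine ⟨?_, hx.2⟩
      have h1 := hx.1
      have h2 := hk.1
      rw [Equiv.swap_apply_def]
      split_ifs <;> simp only [Fin.lt_def, Fin.ext_iff, ne_eq] at * <;> omega
    · intro x _; exact Equiv.swap_apply_self i j x
    · intro x _; exact Equiv.swap_apply_self i j x
  unfold PS
  rw [← Finset.mul_prod_erase S _ hj, ← Finset.mul_prod_erase S' _ hi', hE,
    mul_comm (X i - _), TG_sym_mul t1 hne, TG_lin hne, mul_comm]
  · congr 1
    · apply Finset.prod_congr rfl
      intro k hk
      rw [hD2 k hk]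
    · rw [hD1, pow_succ']; congr 2; ring
  · rw [map_prod]
    apply Finset.prod_congr rfl
    intro k hk
    rw [Finset.mem_erase] at hk
    have hki : k ≠ i := by rintro rfl; exact hi hk.2
    rw [map_sub, rename_X, rename_C, Equiv.swap_apply_of_ne_of_ne hki hk.1]

theorem ind_pos {n : ℕ} {S : Finset (Fin n)} {x : Fin n} : 0 < ind S x ↔ x ∈ S := by
  unfold ind; split_ifs with h <;> simp [h]

theorem FSum_eq {n : ℕ} {l : Fin n → ℕ} (hl : IsPartition l) : ∀ (m : ℕ) (S : Finset (Fin n)),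
    inv (ind S) = m → S.card = npos l → FSum l S = PS S * HS (dn l) := by
  intro m
  induction m with
  | zero =>
    intro S hm hS
    by_cases hp : IsPartition (ind S)
    · have : S = Il n (npos l) := by
        ext x
        rw [mem_Il, ← ind_pos, pos_iff hp, ← hS]
        have : npos (ind S) = S.card := by
          unfold npos
          congr 1
          ext y
          simp [ind_pos]
        rw [this]
      rw [this]; exact FSum_Il hl
    · obtain ⟨i, j, hij, h⟩ := exists_asc _ hp
      have := inv_swap _ hij h
      omega
  | succ m ih =>
    intro S hm hS
    by_cases hp : IsPartition (ind S)
    · rw [inv_part hp] at hm; omega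
    · obtain ⟨i, j, hij, h⟩ := exists_asc _ hp
      have hinv := inv_swap _ hij h
      have hne : i ≠ j := by intro h; subst h; omega
      have hj : j ∈ S := by rw [← ind_pos]; omega
      have hi : i ∉ S := by
        intro hi
        unfold ind at h
        rw [if_pos hi] at h
        split_ifs at h <;> omega
      let S' := S.map (Equiv.swap i j).toEmbedding
      have hS' : ∀ x, x ∈ S' ↔ Equiv.swap i j x ∈ S := by
        intro x
        rw [Finset.mem_map_equiv, Equiv.symm_swap]
      have hind : ind S' = ind S ∘ Equiv.swap i j := by
        funext x
        simp only [ind, Function.comp, hS']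
      have h1 := ih S' (by rw [hind]; omega) (by rw [Finset.card_map]; exact hS)
      obtain ⟨f, H, hs, hc⟩ := HS_good (dn_part hl)
      rw [FSum_step hl hij hi hj hS', h1, PS_step hij hi hj hS', mul_comm,
        TG_sym_mul t1 hne _ _ (hs _), mul_comm]

theorem HS_rec {n : ℕ} {l : Fin n → ℕ} (hl : IsPartition l) :
    HS l = estarElem1 n (npos l) * HS (dn l) := by
  have : HS l = ∑ S ∈ Finset.powersetCard (npos l) (Finset.univ : Finset (Fin n)), FSum l S := by
    unfold HS FSum
    rw [Finset.sum_fiberwise_of_maps_to]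
    intro μ hμ
    rw [Finset.mem_powersetCard]
    exact ⟨Finset.subset_univ _, card_suppF (mem_SnF.mp hμ)⟩
  rw [this]
  unfold estarElem1
  rw [Finset.sum_mul]
  apply Finset.sum_congr rfl
  intro S hS
  rw [FSum_eq hl _ S rfl (Finset.mem_powersetCard.mp hS).2]
  rfl

theorem conj_dn {n : ℕ} (l : Fin n → ℕ) (m : ℕ) : conjPart (dn l) (m + 1) = conjPart l (m + 2) := by
  unfold conjPart dn
  congr 1
  ext x
  simp only [Finset.mem_filter, Finset.mem_univ, true_and]
  omega

theorem HS_eq {n : ℕ} (hn : 1 ≤ n) : ∀ (m : ℕ) (l : Fin n → ℕ), IsPartition l → l ⟨0, hn⟩ = m →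
    HS l = ∏ i ∈ Finset.range m, estarElem1 n (conjPart l (i + 1)) := by
  intro m
  induction m with
  | zero =>
    intro l hl h
    have h0 : l = fun _ => 0 := by
      funext i
      have := hl ⟨0, hn⟩ i (by rw [Fin.le_def]; simp)
      omega
    obtain ⟨f, H, -, -⟩ := HS_good hl
    have e : l ∘ Fin.revPerm = fun _ => 0 := by rw [h0]; rfl
    rw [e] at H
    rw [(H.uniq Good.zero).2, Finset.prod_range_zero]
  | succ m ih =>
    intro l hl h
    rw [HS_rec hl, ih (dn l) (dn_part hl) (by unfold dn; omega), Finset.prod_range_succ', mul_comm]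
    congr 1
    apply Finset.prod_congr rfl
    intro i _
    rw [conj_dn]

end IA

/-- partial symmetrization of interpolation ASEP polynomials
factorizes at `q = 1`. -/
theorem statement17 (n : ℕ) (hn : 1 ≤ n) (l : Fin n → ℕ) (hl : IsPartition l)
    (hl1 : 0 < l ⟨0, hn⟩) (S : Finset (Fin n))
    (hS : S.card = (Finset.univ.filter (fun i : Fin n => 0 < l i)).card) :
    ∃ g : (Fin n → ℕ) → MvPolynomial (Fin n) K1,
      (∀ μ ∈ Sn l, ∀ m : Fin n →₀ ℕ, RegAtQ1 (coeff m (fstar μ)) (coeff m (g μ))) ∧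
      (∑ μ ∈ (SnFinset l).filter
          (fun μ => Finset.univ.filter (fun i : Fin n => 0 < μ i) = S), g μ) =
        (∏ i ∈ S,
          (X i - C (t1 ^ (Finset.univ.filter (fun j : Fin n => j < i ∧ j ∉ S)).card
            / t1 ^ (n - 1)))) *
        ∏ i ∈ Finset.range (l ⟨0, hn⟩ - 1), estarElem1 n (conjPart l (i + 2)) := by
  refine ⟨IA.gs, ?_, ?_⟩
  · intro μ hμ m
    obtain ⟨r, h1, h2⟩ := (IA.gs_rg hl (IA.mem_Sn.mp hμ)).coeff m
    rw [← h1, ← h2]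
    exact IA.reg_of_Rl r
  · have h1 := IA.FSum_eq hl _ S rfl hS
    rw [IA.HS_eq hn (l ⟨0, hn⟩ - 1) (IA.dn l) (IA.dn_part hl) rfl] at h1
    simp only [IA.conj_dn] at h1
    exact h1
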